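/- Let G be a finite group which is not supersolvable. Then α(G) ≤ 17/24 = α(S₄), with equality if and only if G ≅ C₂ⁿ × S₄ for some non-negative integer n. -/

import Mathlib

open scoped Classical

/-- The number of cyclic subgroups of a group. -/
noncomputable def numCyclic (G : Type*) [Group G] : ℕ :=
  Nat.card {H : Subgroup G // IsCyclic (↥H)}

/-- `alpha G = c(G) / |G|`, the number of cyclic subgroups divided by the order. -/
noncomputable def alpha (G : Type*) [Group G] : ℚ :=
  (numCyclic G : ℚ) / (Nat.card G : ℚ)

/-- A group is supersolvable if it has a chain of normal subgroups from the trivial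
subgroup to the whole group such that each successive factor is cyclic, i.e. each
term of the chain is obtained from the previous one by adjoining a single element. -/
def IsSupersolvable (G : Type*) [Group G] : Prop :=
  ∃ (n : ℕ) (s : Fin (n + 1) → Subgroup G),
    s 0 = ⊥ ∧ s (Fin.last n) = ⊤ ∧
    (∀ i : Fin (n + 1), (s i).Normal) ∧
    ∀ i : Fin n, ∃ x : G, s i.succ = s i.castSucc ⊔ Subgroup.zpowers x

/-- The set of solutions of `x ^ 2 = 1`. -/
def sqOne (G : Type*) [Group G] : Set G := {x | x * x = 1}

theorem mem_sqOne {G : Type*} [Group G] {x : G} : x ∈ sqOne G ↔ x * x = 1 := Iff.rfl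

theorem card_zpowers_eq {G : Type*} [Group G] [Fintype G] (g : G) :
    (Finset.univ.filter fun x : G => Subgroup.zpowers x = Subgroup.zpowers g).card =
      (orderOf g).totient := by
  have key := IsCyclic.card_orderOf_eq_totient (α := Subgroup.zpowers g) (d := orderOf g)
    (by rw [Fintype.card_zpowers])
  rw [← key]
  symm
  refine Finset.card_bij (fun a _ => (a : G)) ?_ ?_ ?_
  · intro a ha
    simp only [Finset.mem_filter, Finset.mem_univ, true_and] at ha ⊢
    apply Subgroup.eq_of_le_of_card_ge
    · exact (Subgroup.zpowers_le).2 a.2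
    · rw [Nat.card_zpowers, Nat.card_zpowers, ← ha, Subgroup.orderOf_coe]
  · intro a _ b _ hab
    exact Subtype.ext hab
  · intro b hb
    simp only [Finset.mem_filter, Finset.mem_univ, true_and] at hb
    have hb' : b ∈ Subgroup.zpowers g := hb ▸ Subgroup.mem_zpowers b
    refine ⟨⟨b, hb'⟩, ?_, rfl⟩
    simp only [Finset.mem_filter, Finset.mem_univ, true_and]
    rw [Subgroup.orderOf_mk, ← Nat.card_zpowers, hb, Nat.card_zpowers]

theorem numCyclic_eq_sum {G : Type*} [Group G] [Fintype G] :
    (numCyclic G : ℚ) = ∑ x : G, (1 : ℚ) / (orderOf x).totient := by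
  let f : G → {H : Subgroup G // IsCyclic H} := fun x => ⟨Subgroup.zpowers x, inferInstance⟩
  have hfib : ∀ H : {H : Subgroup G // IsCyclic H},
      ∑ x ∈ Finset.univ.filter (fun x => f x = H), (1 : ℚ) / (orderOf x).totient = 1 := by
    rintro ⟨H, hH⟩
    obtain ⟨g, rfl⟩ := (Subgroup.isCyclic_iff_exists_zpowers_eq_top H).1 hH
    have h1 : ∀ x ∈ Finset.univ.filter (fun x => f x = ⟨Subgroup.zpowers g, hH⟩),
        (1 : ℚ) / (orderOf x).totient = 1 / (orderOf g).totient := by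
      intro x hx
      simp only [f, Finset.mem_filter, Finset.mem_univ, true_and, Subtype.mk.injEq] at hx
      rw [← Nat.card_zpowers x, hx, Nat.card_zpowers]
    rw [Finset.sum_congr rfl h1, Finset.sum_const]
    simp only [f, Subtype.mk.injEq]
    rw [card_zpowers_eq, nsmul_eq_mul]
    have : ((orderOf g).totient : ℚ) ≠ 0 := by
      exact_mod_cast (Nat.totient_pos.2 (orderOf_pos g)).ne'
    field_simp
  rw [← Finset.sum_fiberwise (s := Finset.univ) (g := f), Finset.sum_congr rfl (fun H _ => hfib H)]
  simp [numCyclic]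

theorem card_sqOne_eq_sum {G : Type*} [Group G] [Fintype G] :
    ((sqOne G).ncard : ℚ) = ∑ x : G, if x * x = 1 then (1 : ℚ) else 0 := by
  have h : sqOne G = (Finset.univ.filter fun x : G => x * x = 1 : Finset G) := by
    ext; simp [sqOne]
  rw [h, Set.ncard_coe_finset]
  simp

theorem totient_orderOf_of_sq {G : Type*} [Group G] {x : G} (h : x * x = 1) :
    (orderOf x).totient = 1 := by
  have : orderOf x ∣ 2 := orderOf_dvd_of_pow_eq_one (by rw [pow_two, h])
  rcases (Nat.dvd_prime Nat.prime_two).1 this with h | h <;> simp [h]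

theorem two_lt_orderOf {G : Type*} [Group G] [Finite G] {x : G} (h : x * x ≠ 1) :
    2 < orderOf x := by
  by_contra hlt
  have h0 := orderOf_pos x
  have : orderOf x ∣ 2 := by
    interval_cases orderOf x <;> norm_num
  exact h (by rw [← pow_two]; exact orderOf_dvd_iff_pow_eq_one.1 this)

/-- A group of cyclic proportion `α` has proportion of square roots of `1` at least `2α - 1`. -/
theorem two_mul_numCyclic_le {G : Type*} [Group G] [Fintype G] :
    2 * (numCyclic G : ℚ) ≤ Nat.card G + (sqOne G).ncard := by
  have : (Nat.card G : ℚ) = ∑ x : G, 1 := by simp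
  rw [numCyclic_eq_sum, card_sqOne_eq_sum, this, ← Finset.sum_add_distrib, Finset.mul_sum]
  refine Finset.sum_le_sum fun x _ => ?_
  split_ifs with h
  · rw [totient_orderOf_of_sq h]; norm_num
  · have h2 := Nat.totient_even (two_lt_orderOf h)
    have h3 := Nat.totient_pos.2 (orderOf_pos x)
    have h4 : 2 ≤ (orderOf x).totient := Nat.le_of_dvd h3 h2.two_dvd
    have h5 : (2 : ℚ) ≤ (orderOf x).totient := by exact_mod_cast h4
    rw [mul_one_div, div_le_iff₀ (by linarith)]
    linarith

theorem two_mul_numCyclic_eq {G : Type*} [Group G] [Fintype G]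
    (hG : ∀ x : G, x * x = 1 ∨ x ^ 4 = 1 ∨ x ^ 6 = 1) :
    2 * (numCyclic G : ℚ) = Nat.card G + (sqOne G).ncard := by
  have : (Nat.card G : ℚ) = ∑ x : G, 1 := by simp
  rw [numCyclic_eq_sum, card_sqOne_eq_sum, this, ← Finset.sum_add_distrib, Finset.mul_sum]
  refine Finset.sum_congr rfl fun x _ => ?_
  split_ifs with h
  · rw [totient_orderOf_of_sq h]; norm_num
  · have h1 := two_lt_orderOf h
    have h2 : (orderOf x).totient = 2 := by
      rcases (hG x).resolve_left h with h4 | h6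
      · have hd := orderOf_dvd_of_pow_eq_one h4
        have := Nat.le_of_dvd (by norm_num) hd
        interval_cases orderOf x
        · omega
        · decide
      · have hd := orderOf_dvd_of_pow_eq_one h6
        have := Nat.le_of_dvd (by norm_num) hd
        interval_cases orderOf x
        · decide
        · omega
        · omega
        · decide
    rw [h2]; norm_num

set_option maxRecDepth 10000 in
theorem perm_four_pow (x : Equiv.Perm (Fin 4)) : x * x = 1 ∨ x ^ 4 = 1 ∨ x ^ 3 = 1 := by
  revert x; decide

set_option maxRecDepth 10000 in
theorem card_sqOne_perm_four : (sqOne (Equiv.Perm (Fin 4))).ncard = 10 := by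
  have : sqOne (Equiv.Perm (Fin 4)) =
      (Finset.univ.filter fun x : Equiv.Perm (Fin 4) => x * x = 1 : Finset _) := by
    ext; simp [sqOne]
  rw [this, Set.ncard_coe_finset]
  decide

theorem card_sqOne_congr {G H : Type*} [Group G] [Group H] (e : G ≃* H) :
    (sqOne G).ncard = (sqOne H).ncard := by
  refine Set.ncard_congr' (e.toEquiv.subtypeEquiv fun a => ?_)
  change a * a = 1 ↔ e a * e a = 1
  rw [← map_mul, map_eq_one_iff e e.injective]

theorem alpha_eq_of_mulEquiv {G A : Type*} [Group G] [Finite G] [Group A] [Finite A]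
    (hA : ∀ a : A, a * a = 1) (e : G ≃* A × Equiv.Perm (Fin 4)) : alpha G = 17 / 24 := by
  cases nonempty_fintype G
  have hcard : Nat.card G = Nat.card A * 24 := by
    rw [Nat.card_congr e.toEquiv, Nat.card_prod, Nat.card_perm]
    simp [Nat.factorial]
  have hpow : ∀ y : A × Equiv.Perm (Fin 4), y * y = 1 ∨ y ^ 4 = 1 ∨ y ^ 6 = 1 := by
    rintro ⟨a, x⟩
    have h2 : a ^ 2 = 1 := by rw [pow_two, hA]
    rcases perm_four_pow x with h | h | h
    · left; ext1 <;> simp [hA, h]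
    · right; left
      ext1
      · simp [pow_mul a 2 2, h2]
      · simp [h]
    · right; right
      ext1
      · simp [pow_mul a 2 3, h2]
      · simp [pow_mul x 3 2, h]
  have hsq : (sqOne G).ncard = Nat.card A * 10 := by
    rw [card_sqOne_congr e, ← card_sqOne_perm_four, ← Set.ncard_univ, ← Set.ncard_prod]
    congr 1
    ext ⟨a, x⟩
    simp [sqOne, hA, Prod.ext_iff]
  have h := two_mul_numCyclic_eq (G := G) (fun x => by
    rcases hpow (e x) with h | h | h
    · left; apply e.injective; simpa using h
    · right; left; apply e.injective; simpa using h
    · right; right; apply e.injective; simpa using h)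
  rw [hcard, hsq] at h
  rw [alpha, hcard]
  have hpos : (0 : ℚ) < Nat.card A := by exact_mod_cast Nat.card_pos
  push_cast at h ⊢
  rw [div_eq_div_iff (by positivity) (by norm_num)]
  linarith

theorem mem_normalizer_zpowers {H : Type*} [Group H] [Finite H] {g x : H} :
    x ∈ Subgroup.normalizer (Subgroup.zpowers g : Set H) ↔
      x * g * x⁻¹ ∈ Subgroup.zpowers g := by
  refine ⟨fun h => (Subgroup.mem_normalizer_iff.1 h g).1 (Subgroup.mem_zpowers g), fun h => ?_⟩
  rw [Subgroup.mem_normalizer_iff_map_conj_eq]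
  refine Subgroup.eq_of_le_of_card_ge ?_ ?_
  · rw [MonoidHom.map_zpowers, Subgroup.zpowers_le]
    simpa using h
  · rw [Subgroup.card_map_of_injective (MulAut.conj x).injective]

theorem inverts_zpow {H : Type*} [Group H] {s c : H} (h : s * c * s⁻¹ = c⁻¹) (k : ℤ) :
    s * c ^ k * s⁻¹ = (c ^ k)⁻¹ := by
  rw [← conj_zpow, h, inv_zpow]

/-- The number of elements common to the translates `a • sqOne H` and `b • sqOne H`. -/
noncomputable def overlap {H : Type*} [Group H] (a b : H) : ℕ :=
  {x : H | a⁻¹ * x ∈ sqOne H ∧ b⁻¹ * x ∈ sqOne H}.ncard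

theorem inverts_of_mem_overlap {H : Type*} [Group H] {a b g x : H}
    (hg : g ∈ Subgroup.zpowers (a⁻¹ * b)) (h₁ : a⁻¹ * x ∈ sqOne H) (h₂ : b⁻¹ * x ∈ sqOne H) :
    (a⁻¹ * x) * g * (a⁻¹ * x)⁻¹ = g⁻¹ := by
  obtain ⟨k, rfl⟩ := hg
  refine inverts_zpow ?_ k
  obtain ⟨s, rfl⟩ : ∃ s, x = a * s := ⟨a⁻¹ * x, by group⟩
  obtain ⟨c, rfl⟩ : ∃ c, b = a * c := ⟨a⁻¹ * b, by group⟩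
  simp only [mem_sqOne, inv_mul_cancel_left, mul_inv_rev] at h₁ h₂ ⊢
  have h3 : c⁻¹ * s * (c⁻¹ * s) = 1 := by
    rw [← h₂]; group
  have h4 : s⁻¹ = s := inv_eq_of_mul_eq_one_left h₁
  rw [h4]
  have h5 : s * c⁻¹ * s = c := by
    have : c⁻¹ * (s * c⁻¹ * s) = 1 := by rw [← h3]; group
    exact (inv_mul_eq_one.1 this).symm
  calc s * c * s = (s⁻¹ * c⁻¹ * s⁻¹)⁻¹ := by group
    _ = c⁻¹ := by rw [h4, h5]

theorem exists_inverts_of_overlap {H : Type*} [Group H] {a b g : H}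
    (hg : g ∈ Subgroup.zpowers (a⁻¹ * b)) (h : overlap a b ≠ 0) :
    ∃ s, s * g * s⁻¹ = g⁻¹ := by
  obtain ⟨x, h₁, h₂⟩ := Set.nonempty_of_ncard_ne_zero h
  exact ⟨_, inverts_of_mem_overlap hg h₁ h₂⟩

theorem overlap_le {H : Type*} [Group H] [Finite H] {a b g : H}
    (hg : g ∈ Subgroup.zpowers (a⁻¹ * b)) :
    overlap a b ≤ Nat.card (Subgroup.centralizer {g}) := by
  by_cases h0 : overlap a b = 0
  · omega
  obtain ⟨s, hs⟩ := Set.nonempty_of_ncard_ne_zero h0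
  have hs' := inverts_of_mem_overlap hg hs.1 hs.2
  refine Set.ncard_le_ncard_of_injOn
    (t := (Subgroup.centralizer {g} : Set H)) (fun x => (a⁻¹ * s)⁻¹ * (a⁻¹ * x)) ?_ ?_
    (Set.toFinite _)
  · intro x hx
    have hx' := inverts_of_mem_overlap hg hx.1 hx.2
    generalize a⁻¹ * s = u at *
    generalize a⁻¹ * x = v at *
    rw [SetLike.mem_coe, Subgroup.mem_centralizer_singleton_iff]
    have : v * g * v⁻¹ = u * g * u⁻¹ := hx'.trans hs'.symm
    calc u⁻¹ * v * g = u⁻¹ * (v * g * v⁻¹) * v := by group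
      _ = g * (u⁻¹ * v) := by rw [this]; group
  · intro x _ y _ hxy
    simpa using hxy

theorem card_translate_sqOne {H : Type*} [Group H] [Fintype H] (a : H) :
    ∑ x : H, (if a⁻¹ * x ∈ sqOne H then 1 else 0) = (sqOne H).ncard := by
  rw [← Equiv.sum_comp (Equiv.mulLeft a)]
  simp only [Equiv.coe_mulLeft, inv_mul_cancel_left]
  rw [← Finset.card_filter, ← Set.ncard_coe_finset]
  simp

theorem overlap_eq_sum {H : Type*} [Group H] [Fintype H] (a b : H) :
    overlap a b = ∑ x : H, (if a⁻¹ * x ∈ sqOne H ∧ b⁻¹ * x ∈ sqOne H then 1 else 0) := by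
  rw [← Finset.card_filter, ← Set.ncard_coe_finset]
  simp [overlap]

theorem three_mul_card_sqOne_le {H : Type*} [Group H] [Finite H] (a b c : H) :
    3 * (sqOne H).ncard ≤ Nat.card H + (overlap a b + overlap a c + overlap b c) := by
  cases nonempty_fintype H
  have h1 : Nat.card H = ∑ x : H, 1 := by simp
  have h3 : 3 * (sqOne H).ncard = (sqOne H).ncard + (sqOne H).ncard + (sqOne H).ncard := by ring
  rw [h3]
  nth_rewrite 1 [← card_translate_sqOne a]
  nth_rewrite 1 [← card_translate_sqOne b]
  rw [← card_translate_sqOne c]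
  simp only [overlap_eq_sum, h1, ← Finset.sum_add_distrib]
  refine Finset.sum_le_sum fun x _ => ?_
  by_cases ha : a⁻¹ * x ∈ sqOne H <;> by_cases hb : b⁻¹ * x ∈ sqOne H <;>
    by_cases hc : c⁻¹ * x ∈ sqOne H <;> simp [ha, hb, hc]

theorem four_mul_card_sqOne_le {H : Type*} [Group H] [Finite H] (a b c d : H) :
    4 * (sqOne H).ncard ≤ Nat.card H +
      (overlap a b + overlap a c + overlap a d + overlap b c + overlap b d + overlap c d) := by
  cases nonempty_fintype H
  have h1 : Nat.card H = ∑ x : H, 1 := by simp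
  have h3 : 4 * (sqOne H).ncard =
    (sqOne H).ncard + (sqOne H).ncard + (sqOne H).ncard + (sqOne H).ncard := by ring
  rw [h3]
  nth_rewrite 1 [← card_translate_sqOne a]
  nth_rewrite 1 [← card_translate_sqOne b]
  nth_rewrite 1 [← card_translate_sqOne c]
  rw [← card_translate_sqOne d]
  simp only [overlap_eq_sum, h1, ← Finset.sum_add_distrib]
  refine Finset.sum_le_sum fun x _ => ?_
  by_cases ha : a⁻¹ * x ∈ sqOne H <;> by_cases hb : b⁻¹ * x ∈ sqOne H <;>
    by_cases hc : c⁻¹ * x ∈ sqOne H <;> by_cases hd : d⁻¹ * x ∈ sqOne H <;>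
    simp [ha, hb, hc, hd]

theorem two_mul_card_centralizer_le {H : Type*} [Group H] [Finite H] {g : H}
    (hg : g * g ≠ 1) (hs : ∃ s, s * g * s⁻¹ = g⁻¹) :
    2 * Nat.card (Subgroup.centralizer {g}) ≤
      Nat.card (Subgroup.normalizer (Subgroup.zpowers g : Set H)) := by
  obtain ⟨s, hs⟩ := hs
  have hle : Subgroup.centralizer {g} ≤ Subgroup.normalizer (Subgroup.zpowers g : Set H) := by
    intro x hx
    rw [Subgroup.mem_centralizer_singleton_iff] at hx
    rw [mem_normalizer_zpowers, hx, mul_inv_cancel_right]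
    exact Subgroup.mem_zpowers g
  have hsN : s ∈ Subgroup.normalizer (Subgroup.zpowers g : Set H) := by
    rw [mem_normalizer_zpowers, hs]
    exact inv_mem (Subgroup.mem_zpowers g)
  have hsC : s ∉ Subgroup.centralizer {g} := by
    rw [Subgroup.mem_centralizer_singleton_iff]
    intro h
    rw [h, mul_inv_cancel_right] at hs
    exact hg (mul_eq_one_iff_eq_inv.2 hs)
  have hmul := Subgroup.relIndex_mul_relIndex ⊥ _ _ bot_le hle
  rw [Subgroup.relIndex_bot_left, Subgroup.relIndex_bot_left] at hmul
  rw [← hmul, mul_comm]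
  refine Nat.mul_le_mul_left _ ?_
  have h0 : (Subgroup.centralizer {g}).relIndex
      (Subgroup.normalizer (Subgroup.zpowers g : Set H)) ≠ 0 :=
    Subgroup.index_ne_zero_of_finite
  have h1 : (Subgroup.centralizer {g}).relIndex
      (Subgroup.normalizer (Subgroup.zpowers g : Set H)) ≠ 1 := by
    rw [Ne, Subgroup.relIndex_eq_one]
    exact fun h => hsC (h hsN)
  omega

theorem mul_self_ne_one_of_prime {H : Type*} [Group H] {g : H} {p : ℕ} (hp : 2 < p)
    (hg : orderOf g = p) : g * g ≠ 1 := by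
  intro h
  rw [← pow_two] at h
  have := Nat.le_of_dvd (by norm_num) (orderOf_dvd_of_pow_eq_one h)
  omega

theorem index_normalizer_le_six {H : Type*} [Group H] [Finite H]
    (hH : 5 * Nat.card H ≤ 12 * (sqOne H).ncard) {g : H} (hg : orderOf g = 3) :
    (Subgroup.normalizer (Subgroup.zpowers g : Set H)).index ≤ 6 := by
  have hk : ∀ k : ℕ, k.Coprime 3 → g ∈ Subgroup.zpowers (g ^ k) := fun k hk => by
    rw [mem_zpowers_pow_iff, hg]; exact hk
  have h01 : g ∈ Subgroup.zpowers ((1 : H)⁻¹ * g) := by simp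
  have h02 : g ∈ Subgroup.zpowers ((1 : H)⁻¹ * g ^ 2) := by simpa using hk 2 (by norm_num)
  have h12 : g ∈ Subgroup.zpowers (g⁻¹ * g ^ 2) := by
    rw [show g⁻¹ * g ^ 2 = g by group]; exact Subgroup.mem_zpowers g
  have hsum := three_mul_card_sqOne_le 1 g (g ^ 2)
  have hpos : 0 < Nat.card H := Nat.card_pos
  have hinv : ∃ s, s * g * s⁻¹ = g⁻¹ := by
    by_cases e1 : overlap 1 g = 0
    · by_cases e2 : overlap 1 (g ^ 2) = 0
      · exact exists_inverts_of_overlap h12 (by omega)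
      · exact exists_inverts_of_overlap h02 e2
    · exact exists_inverts_of_overlap h01 e1
  have hC := two_mul_card_centralizer_le (mul_self_ne_one_of_prime (by norm_num) hg) hinv
  have hI := (Subgroup.normalizer (Subgroup.zpowers g : Set H)).index_mul_card
  have l1 := overlap_le h01
  have l2 := overlap_le h02
  have l3 := overlap_le h12
  by_contra hlt
  push Not at hlt
  have := Nat.mul_le_mul_right
    (Nat.card (Subgroup.normalizer (Subgroup.zpowers g : Set H))) (Nat.succ_le_of_lt hlt)
  omega

theorem index_normalizer_le_four {H : Type*} [Group H] [Finite H]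
    (hH : 5 * Nat.card H ≤ 12 * (sqOne H).ncard) {g : H} {p : ℕ} (hp : p.Prime) (h5 : 5 ≤ p)
    (hg : orderOf g = p) :
    (Subgroup.normalizer (Subgroup.zpowers g : Set H)).index ≤ 4 := by
  have hk : ∀ k : ℕ, 0 < k → k < 5 → g ∈ Subgroup.zpowers (g ^ k) := fun k hk0 hk => by
    rw [mem_zpowers_pow_iff, hg]
    exact ((Nat.Prime.coprime_iff_not_dvd hp).2
      (fun h => by have := Nat.le_of_dvd hk0 h; omega)).symm
  have key : ∀ i k : ℕ, 0 < k → k < 5 → g ∈ Subgroup.zpowers ((g ^ i)⁻¹ * g ^ (i + k)) := by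
    intro i k h0 h1
    rw [pow_add, inv_mul_cancel_left]
    exact hk k h0 h1
  have hsum := four_mul_card_sqOne_le (g ^ 0) (g ^ 1) (g ^ 2) (g ^ 3)
  have hpos : 0 < Nat.card H := Nat.card_pos
  have h01 := key 0 1 (by norm_num) (by norm_num)
  have h02 := key 0 2 (by norm_num) (by norm_num)
  have h03 := key 0 3 (by norm_num) (by norm_num)
  have h12 := key 1 1 (by norm_num) (by norm_num)
  have h13 := key 1 2 (by norm_num) (by norm_num)
  have h23 := key 2 1 (by norm_num) (by norm_num)
  simp only [Nat.reduceAdd] at h01 h02 h03 h12 h13 h23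
  have hinv : ∃ s, s * g * s⁻¹ = g⁻¹ := by
    by_contra hno
    have hz : ∀ a b : H, g ∈ Subgroup.zpowers (a⁻¹ * b) → overlap a b = 0 := by
      intro a b hab
      by_contra h
      exact hno (exists_inverts_of_overlap hab h)
    have := hz _ _ h01
    have := hz _ _ h02
    have := hz _ _ h03
    have := hz _ _ h12
    have := hz _ _ h13
    have := hz _ _ h23
    omega
  have hC := two_mul_card_centralizer_le (mul_self_ne_one_of_prime (by omega) hg) hinv
  have hI := (Subgroup.normalizer (Subgroup.zpowers g : Set H)).index_mul_card
  have := overlap_le h01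
  have := overlap_le h02
  have := overlap_le h03
  have := overlap_le h12
  have := overlap_le h13
  have := overlap_le h23
  by_contra hlt
  push Not at hlt
  have := Nat.mul_le_mul_right
    (Nat.card (Subgroup.normalizer (Subgroup.zpowers g : Set H))) (Nat.succ_le_of_lt hlt)
  omega

set_option maxRecDepth 10000 in
theorem isSolvable_perm_four : Group.IsSolvable (Equiv.Perm (Fin 4)) := by
  have hmul : ∀ a b : Equiv.Perm (Fin 4), a * a = 1 ∧ Equiv.Perm.sign a = 1 →
      b * b = 1 ∧ Equiv.Perm.sign b = 1 →
      (a * b) * (a * b) = 1 ∧ Equiv.Perm.sign (a * b) = 1 := by decide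
  let V : Subgroup (Equiv.Perm (Fin 4)) :=
    { carrier := {a | a * a = 1 ∧ Equiv.Perm.sign a = 1}
      mul_mem' := fun {a b} ha hb => hmul a b ha hb
      one_mem' := by simp
      inv_mem' := fun {a} ha => by
        refine ⟨?_, by simpa using ha.2⟩
        rw [← mul_inv_rev, ha.1, inv_one] }
  have h1 : derivedSeries (Equiv.Perm (Fin 4)) 1 ≤ (Equiv.Perm.sign (α := Fin 4)).ker := by
    rw [derivedSeries_one]
    exact Abelianization.commutator_subset_ker _
  have h2 : derivedSeries (Equiv.Perm (Fin 4)) 2 ≤ V := by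
    rw [derivedSeries_succ]
    refine (Subgroup.commutator_mono h1 h1).trans (Subgroup.commutator_le.2 ?_)
    have : ∀ a b : Equiv.Perm (Fin 4), Equiv.Perm.sign a = 1 → Equiv.Perm.sign b = 1 →
      (a * b * a⁻¹ * b⁻¹) * (a * b * a⁻¹ * b⁻¹) = 1 ∧
        Equiv.Perm.sign (a * b * a⁻¹ * b⁻¹) = 1 := by decide
    intro a ha b hb
    exact this a b ha hb
  refine ⟨⟨3, eq_bot_iff.2 ?_⟩⟩
  rw [derivedSeries_succ]
  refine (Subgroup.commutator_mono h2 h2).trans (Subgroup.commutator_le.2 ?_)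
  have : ∀ a b : Equiv.Perm (Fin 4), a * a = 1 ∧ Equiv.Perm.sign a = 1 →
      b * b = 1 ∧ Equiv.Perm.sign b = 1 → a * b * a⁻¹ * b⁻¹ = 1 := by decide
  intro a ha b hb
  exact this a b ha hb

theorem zpowers_le_of_prime {H : Type*} [Group H] {a : H} (ha : (orderOf a).Prime)
    {L : Subgroup H} (hL : Subgroup.zpowers a ⊓ L ≠ ⊥) : a ∈ L := by
  have : Fact (Nat.card (Subgroup.zpowers a)).Prime := ⟨by rwa [Nat.card_zpowers]⟩
  rcases (L.subgroupOf (Subgroup.zpowers a)).eq_bot_or_eq_top_of_prime_card with h | h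
  · rw [Subgroup.subgroupOf_eq_bot, disjoint_iff, inf_comm] at h
    exact absurd h hL
  · rw [Subgroup.subgroupOf_eq_top] at h
    exact h (Subgroup.mem_zpowers a)

theorem commute_of_mem_zpowers_conj {H : Type*} [Group H] {a b : H} (ha : (orderOf a).Prime)
    (h₁ : a * b * a⁻¹ ∈ Subgroup.zpowers b) (h₂ : b * a * b⁻¹ ∈ Subgroup.zpowers a) :
    a * b = b * a := by
  by_cases h : Subgroup.zpowers a ⊓ Subgroup.zpowers b = ⊥
  · have hb : a * b * a⁻¹ * b⁻¹ ∈ Subgroup.zpowers b :=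
      mul_mem h₁ (inv_mem (Subgroup.mem_zpowers b))
    have ha : a * b * a⁻¹ * b⁻¹ ∈ Subgroup.zpowers a := by
      have := mul_mem (Subgroup.mem_zpowers a) (inv_mem h₂)
      convert this using 1
      group
    have : a * b * a⁻¹ * b⁻¹ ∈ (⊥ : Subgroup H) := h ▸ Subgroup.mem_inf.2 ⟨ha, hb⟩
    rw [Subgroup.mem_bot, mul_inv_eq_one, mul_inv_eq_iff_eq_mul] at this
    exact this
  · obtain ⟨k, hk⟩ := zpowers_le_of_prime ha h
    change b ^ k = a at hk
    rw [← hk]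
    exact ((Commute.refl b).zpow_left k).eq

/-- `N` is a minimal nontrivial normal subgroup. -/
structure IsMinNormal {H : Type*} [Group H] (N : Subgroup H) : Prop where
  normal : N.Normal
  ne_bot : N ≠ ⊥
  eq_bot_or_eq : ∀ L : Subgroup H, L.Normal → L ≤ N → L = ⊥ ∨ L = N

theorem IsMinNormal.commute_of_forall_conj {H : Type*} [Group H] [Finite H] {N : Subgroup H}
    (hN : IsMinNormal N) {g : H} (hgN : g ∈ N) (hg : (orderOf g).Prime)
    (h : ∀ x : H, x * g * x⁻¹ ∈ Subgroup.normalizer (Subgroup.zpowers g : Set H)) :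
    ∀ x ∈ N, ∀ y ∈ N, x * y = y * x := by
  have hnorm : ∀ x y : H, (x * g * x⁻¹) * (y * g * y⁻¹) * (x * g * x⁻¹)⁻¹ ∈
      Subgroup.zpowers (y * g * y⁻¹) := by
    intro x y
    have := mem_normalizer_zpowers.1 (h (y⁻¹ * x))
    obtain ⟨k, hk⟩ := this
    refine ⟨k, ?_⟩
    change g ^ k = _ at hk
    change (y * g * y⁻¹) ^ k = _
    rw [conj_zpow, hk]
    group
  have hord : ∀ x : H, (orderOf (x * g * x⁻¹)).Prime := fun x => by
    have : x * g * x⁻¹ = MulAut.conj x g := rfl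
    rwa [this, MulEquiv.orderOf_eq]
  have hcl : Subgroup.normalClosure {g} = N := by
    refine (hN.eq_bot_or_eq _ inferInstance ?_).resolve_left ?_
    · have := hN.normal
      exact Subgroup.normalClosure_le_normal (by simpa using hgN)
    · intro hb
      have : g ∈ Subgroup.normalClosure {g} := Subgroup.subset_normalClosure rfl
      rw [hb, Subgroup.mem_bot] at this
      rw [this, orderOf_one] at hg
      exact Nat.not_prime_one hg
  have hcomm : ∀ x ∈ Group.conjugatesOfSet {g}, ∀ y ∈ Group.conjugatesOfSet {g},
      x * y = y * x := by
    simp only [Group.mem_conjugatesOfSet_iff, Set.mem_singleton_iff, exists_eq_left, isConj_iff]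
    rintro _ ⟨x, rfl⟩ _ ⟨y, rfl⟩
    exact commute_of_mem_zpowers_conj (hord x) (hnorm x y) (hnorm y x)
  have hc : IsMulCommutative N := by
    rw [← hcl]
    exact Subgroup.isMulCommutative_closure hcomm
  intro x hx y hy
  exact Subgroup.mem_centralizer_iff.1 (Subgroup.le_centralizer_iff_isMulCommutative.2 hc hy) x hx

theorem conj_mem_of_toPermHom_eq_one {H : Type*} [Group H] {Y : Subgroup H} {g : H}
    (hg : MulAction.toPermHom H (H ⧸ Y) g = 1) (x : H) : x * g * x⁻¹ ∈ Y := by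
  have : g ∈ Y.normalCore := by
    rw [Subgroup.normalCore_eq_ker]; exact hg
  exact this x

theorem IsMinNormal.commute_of_five_le {H : Type*} [Group H] [Finite H] {N : Subgroup H}
    (hN : IsMinNormal N) (hH : 5 * Nat.card H ≤ 12 * (sqOne H).ncard)
    {p : ℕ} (hp : p.Prime) (h5 : 5 ≤ p) {g : H} (hgN : g ∈ N) (hg : orderOf g = p) :
    ∀ x ∈ N, ∀ y ∈ N, x * y = y * x := by
  refine hN.commute_of_forall_conj hgN (hg ▸ hp) (conj_mem_of_toPermHom_eq_one ?_)
  have hi := index_normalizer_le_four hH hp h5 hg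
  set Y := Subgroup.normalizer (Subgroup.zpowers g : Set H)
  rw [← orderOf_eq_one_iff]
  have h1 : orderOf (MulAction.toPermHom H (H ⧸ Y) g) ∣ p := hg ▸ orderOf_map_dvd _ g
  rcases (Nat.dvd_prime hp).1 h1 with h | h
  · exact h
  · exfalso
    have h2 : p ∣ Nat.card (Equiv.Perm (H ⧸ Y)) := h ▸ orderOf_dvd_natCard _
    rw [Nat.card_perm] at h2
    have := (hp.dvd_factorial).1 h2
    have h3 : Nat.card (H ⧸ Y) = Y.index := rfl
    omega

theorem mul_comm_of_orderOf_three {H : Type*} [Group H] [Finite H] {a b : H}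
    (ha : orderOf a = 3) (hb : orderOf b = 3) (h : a * b * a⁻¹ ∈ Subgroup.zpowers b) :
    a * b = b * a := by
  have ha3 : a ^ 3 = 1 := ha ▸ pow_orderOf_eq_one a
  have hb3 : b ^ 3 = 1 := hb ▸ pow_orderOf_eq_one b
  have hb1 : b ≠ 1 := by rintro rfl; simp at hb
  rw [mem_zpowers_iff_mem_range_orderOf, hb] at h
  simp only [Finset.mem_image, Finset.mem_range] at h
  obtain ⟨k, hk, hk'⟩ := h
  interval_cases k
  · exfalso
    apply hb1
    rw [pow_zero, eq_comm, mul_inv_eq_one, mul_eq_left] at hk'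
    exact hk'
  · rw [pow_one, eq_mul_inv_iff_mul_eq] at hk'
    exact hk'.symm
  · exfalso
    apply hb1
    have e1 : ∀ n : ℕ, a * b ^ n * a⁻¹ = b ^ (2 * n) := by
      intro n; rw [← conj_pow, ← hk', pow_mul]
    have e2 : b = b ^ 8 := by
      calc b = a ^ 3 * b ^ 1 * (a ^ 3)⁻¹ := by rw [ha3]; simp
        _ = a * (a * (a * b ^ 1 * a⁻¹) * a⁻¹) * a⁻¹ := by simp [pow_succ, mul_assoc]
        _ = b ^ 8 := by rw [e1, e1, e1]
    calc b = b⁻¹ * b ^ 2 := by group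
      _ = b⁻¹ * b ^ 8 := by rw [show 8 = 3 * 2 + 2 by norm_num, pow_add, pow_mul, hb3]; simp
      _ = 1 := by rw [← e2]; simp

theorem card_dvd_factorial_of_fixes_two {K Ω : Type*} [Group K] [Finite Ω]
    (f : K →* Equiv.Perm Ω) (hf : Function.Injective f) {a b : Ω} (hab : a ≠ b)
    (ha : ∀ k, f k a = a) (hb : ∀ k, f k b = b) :
    Nat.card K ∣ (Nat.card Ω - 2).factorial := by
  cases nonempty_fintype Ω
  let p : Ω → Prop := fun ω => ω ∈ ({a, b} : Finset Ω)ᶜ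
  have hle : f.range ≤ (Equiv.Perm.ofSubtype (p := p)).range := by
    rintro _ ⟨k, rfl⟩
    have hp : ∀ x, p (f k x) ↔ p x := by
      intro x
      have h1 : f k x = a ↔ x = a :=
        ⟨fun h => (f k).injective (h.trans (ha k).symm), fun h => h ▸ ha k⟩
      have h2 : f k x = b ↔ x = b :=
        ⟨fun h => (f k).injective (h.trans (hb k).symm), fun h => h ▸ hb k⟩
      simp [p, h1, h2]
    refine ⟨(f k).subtypePerm hp, Equiv.Perm.ofSubtype_subtypePerm hp ?_⟩
    intro x hx
    by_contra hnp
    simp only [p, Finset.mem_compl, Finset.mem_insert, Finset.mem_singleton, not_not] at hnp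
    rcases hnp with rfl | rfl
    · exact hx (ha k)
    · exact hx (hb k)
  have h1 := Subgroup.card_dvd_of_le hle
  have h2 : Nat.card (Subtype p) = Nat.card Ω - 2 := by
    rw [Nat.card_eq_fintype_card, Nat.card_eq_fintype_card]
    have : Fintype.card (Subtype p) = (({a, b} : Finset Ω)ᶜ).card := Fintype.card_coe _
    rw [this, Finset.card_compl, Finset.card_pair hab]
  rwa [← Nat.card_congr (MonoidHom.ofInjective hf).toEquiv,
    ← Nat.card_congr (MonoidHom.ofInjective Equiv.Perm.ofSubtype_injective).toEquiv,
    Nat.card_perm, h2] at h1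

theorem IsMinNormal.commute_of_isSolvable {H S : Type*} [Group H] [Group S]
    [Group.IsSolvable S] {N : Subgroup H} (hN : IsMinNormal N) (f : H →* S)
    (hf : f.ker ⊓ N = ⊥) : ∀ x ∈ N, ∀ y ∈ N, x * y = y * x := by
  have hnorm := hN.normal
  rcases hN.eq_bot_or_eq _ (Subgroup.commutator_normal N N) (Subgroup.commutator_le_self N) with h | h
  · intro x hx y hy
    rw [Subgroup.commutator_eq_bot_iff_le_centralizer] at h
    exact Subgroup.mem_centralizer_iff.1 (h hy) x hx
  · exfalso
    have h1 : N.map f ≠ ⊥ := by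
      rw [Ne, Subgroup.map_eq_bot_iff]
      intro hle
      rw [inf_eq_right.2 hle] at hf
      exact hN.ne_bot hf
    have h2 := Group.IsSolvable.commutator_lt_of_ne_bot h1
    rw [← Subgroup.map_commutator, h] at h2
    exact lt_irrefl _ h2

theorem IsMinNormal.commute_of_orderOf_three {H : Type*} [Group H] [Finite H] {N : Subgroup H}
    (hN : IsMinNormal N) (hH : 5 * Nat.card H ≤ 12 * (sqOne H).ncard)
    {g : H} (hgN : g ∈ N) (hg : orderOf g = 3) :
    ∀ x ∈ N, ∀ y ∈ N, x * y = y * x := by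
  have hi := index_normalizer_le_six hH hg
  have hprime : (orderOf g).Prime := by rw [hg]; exact Nat.prime_three
  have hnorm := hN.normal
  have mem_Y := @mem_normalizer_zpowers H _ _ g
  generalize hY : Subgroup.normalizer (Subgroup.zpowers g : Set H) = Y at hi mem_Y
  have hgY : g ∈ Y := by
    rw [mem_Y, mul_inv_cancel_right]; exact Subgroup.mem_zpowers g
  let φ := MulAction.toPermHom H (H ⧸ Y)
  have hΩ : Nat.card (H ⧸ Y) = Y.index := rfl
  have hφ : ∀ h x : H, φ h (x : H ⧸ Y) = ((h * x : H) : H ⧸ Y) := fun _ _ => rfl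
  rcases hN.eq_bot_or_eq (φ.ker ⊓ N) inferInstance inf_le_right with hker | hker
  swap
  · refine hN.commute_of_forall_conj hgN hprime ?_
    rw [hY]
    apply conj_mem_of_toPermHom_eq_one
    exact (Subgroup.mem_inf.1 (hker.symm ▸ hgN : g ∈ φ.ker ⊓ N)).1
  have hinj : ∀ x ∈ N, φ x = 1 → x = 1 := fun x hx h => by
    have : x ∈ φ.ker ⊓ N := ⟨h, hx⟩
    rwa [hker] at this
  by_cases hfix : ∃ x : H, x ∉ Y ∧ x⁻¹ * g * x ∈ Y
  · exfalso
    obtain ⟨x, hxY, hx⟩ := hfix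
    set g' := x * g * x⁻¹ with hg'
    have hord' : orderOf g' = 3 := by
      rw [← hg, hg', show x * g * x⁻¹ = MulAut.conj x g from rfl, MulEquiv.orderOf_eq]
    have hcomm : g * g' = g' * g := by
      apply mul_comm_of_orderOf_three hg hord'
      obtain ⟨k, hk⟩ := (mem_Y).1 hx
      refine ⟨k, ?_⟩
      change g ^ k = _ at hk
      change (x * g * x⁻¹) ^ k = _
      rw [conj_zpow, hk, hg']
      group
    have hdisj : Disjoint (Subgroup.zpowers g) (Subgroup.zpowers g') := by
      rw [disjoint_iff]
      by_contra hne
      have h1 : g' ∈ Subgroup.zpowers g :=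
        zpowers_le_of_prime (by rw [hord']; exact Nat.prime_three) (by rwa [inf_comm])
      exact hxY (mem_Y.2 h1)
    have hc : ∀ (m : Subgroup.zpowers g) (n : Subgroup.zpowers g'), Commute (m : H) (n : H) := by
      rintro ⟨_, k, rfl⟩ ⟨_, l, rfl⟩
      exact Commute.zpow_zpow (show Commute g g' from hcomm) k l
    let ψ := MonoidHom.noncommCoprod (Subgroup.zpowers g).subtype (Subgroup.zpowers g').subtype hc
    have hψ : Function.Injective ψ :=
      (MonoidHom.noncommCoprod_injective _ _ _).2
        ⟨Subtype.val_injective, Subtype.val_injective, by simpa using hdisj⟩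
    have hψN : ∀ k, ψ k ∈ N := by
      rintro ⟨⟨_, k, rfl⟩, ⟨_, l, rfl⟩⟩
      exact mul_mem (zpow_mem hgN k) (zpow_mem (hnorm.conj_mem g hgN x) l)
    have hinj' : Function.Injective (φ.comp ψ) := by
      rw [injective_iff_map_eq_one]
      intro k hk
      exact hψ ((hinj _ (hψN k) hk).trans (map_one ψ).symm)
    have hfixed : ∀ y : H, y⁻¹ * g * y ∈ Y → y⁻¹ * g' * y ∈ Y →
        ∀ k, φ.comp ψ k = φ (ψ k) ∧ φ (ψ k) (y : H ⧸ Y) = y := by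
      rintro y h1 h2 ⟨⟨_, k, rfl⟩, ⟨_, l, rfl⟩⟩
      refine ⟨rfl, ?_⟩
      rw [hφ, eq_comm, QuotientGroup.eq]
      change y⁻¹ * (g ^ k * g' ^ l * y) ∈ Y
      have e1 : y⁻¹ * g ^ k * y = (y⁻¹ * g * y) ^ k := by
        have := conj_zpow (a := y⁻¹) (b := g) (i := k)
        rw [inv_inv] at this; exact this.symm
      have e2 : y⁻¹ * g' ^ l * y = (y⁻¹ * g' * y) ^ l := by
        have := conj_zpow (a := y⁻¹) (b := g') (i := l)
        rw [inv_inv] at this; exact this.symm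
      have : y⁻¹ * (g ^ k * g' ^ l * y) = (y⁻¹ * g ^ k * y) * (y⁻¹ * g' ^ l * y) := by group
      rw [this, e1, e2]
      exact mul_mem (zpow_mem h1 k) (zpow_mem h2 l)
    have hg'Y : g' ∈ Y := by
      rw [mem_Y, ← hcomm, mul_inv_cancel_right]
      exact Subgroup.mem_zpowers g
    have hdvd := card_dvd_factorial_of_fixes_two (φ.comp ψ) hinj'
      (a := ((1 : H) : H ⧸ Y)) (b := (x : H ⧸ Y))
      (by rw [Ne, QuotientGroup.eq]; simpa using hxY)
      (fun k => (hfixed 1 (by simpa using hgY) (by simpa using hg'Y) k).2)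
      (fun k => (hfixed x hx (by
        have : x⁻¹ * g' * x = g := by rw [hg']; group
        rw [this]; exact hgY) k).2)
    rw [Nat.card_prod, Nat.card_zpowers, Nat.card_zpowers, hg, hord', hΩ] at hdvd
    have : Y.index - 2 ≤ 4 := by omega
    revert hdvd
    interval_cases Y.index - 2 <;> decide
  · push Not at hfix
    have hmod : Nat.card (H ⧸ Y) ≡ 1 [MOD 3] := by
      have hp : IsPGroup 3 (Subgroup.zpowers g) := IsPGroup.of_card (n := 1) (by
        rw [Nat.card_zpowers, hg, pow_one])
      have := hp.card_modEq_card_fixedPoints (H ⧸ Y)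
      have hone : MulAction.fixedPoints (Subgroup.zpowers g) (H ⧸ Y) = {((1 : H) : H ⧸ Y)} := by
        ext ω
        induction ω using QuotientGroup.induction_on with
        | H y =>
          rw [MulAction.mem_fixedPoints, Set.mem_singleton_iff, eq_comm, QuotientGroup.eq]
          constructor
          · intro h
            have h1 := h ⟨g, Subgroup.mem_zpowers g⟩
            by_contra hy
            refine hfix y (by simpa using hy) ?_
            rw [eq_comm] at h1
            have : y⁻¹ * (g * y) ∈ Y := QuotientGroup.eq.1 h1
            rwa [← mul_assoc] at this
          · intro hy
            rintro ⟨_, k, rfl⟩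
            rw [eq_comm]
            refine QuotientGroup.eq.2 ?_
            have hy' : y ∈ Y := by simpa using hy
            exact mul_mem (inv_mem hy') (mul_mem (zpow_mem hgY k) hy')
      rwa [hone, Nat.card_coe_set_eq {((1 : H) : H ⧸ Y)}, Set.ncard_singleton] at this
    rw [hΩ] at hmod
    have hpos : Y.index ≠ 0 := Subgroup.index_ne_zero_of_finite
    have hcases : Y.index = 1 ∨ Y.index = 4 := by
      unfold Nat.ModEq at hmod
      omega
    rcases hcases with h1 | h4
    · refine hN.commute_of_forall_conj hgN hprime fun x => ?_
      rw [hY, Subgroup.index_eq_one.1 h1]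
      exact Subgroup.mem_top _
    · have e : H ⧸ Y ≃ Fin 4 := Finite.equivFinOfCardEq h4
      have := isSolvable_perm_four
      refine hN.commute_of_isSolvable (e.permCongrHom.toMonoidHom.comp φ) ?_
      rw [eq_bot_iff]
      rintro z ⟨hz, hzN⟩
      refine hinj z hzN ?_
      have : e.permCongrHom (φ z) = 1 := hz
      exact e.permCongrHom.injective (this.trans (map_one e.permCongrHom).symm)

/-- A minimal normal subgroup is abelian when at least `5/12` of the elements square to `1`. -/
theorem IsMinNormal.commute {H : Type*} [Group H] [Finite H] {N : Subgroup H}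
    (hN : IsMinNormal N) (hH : 5 * Nat.card H ≤ 12 * (sqOne H).ncard) :
    ∀ x ∈ N, ∀ y ∈ N, x * y = y * x := by
  by_cases hp : ∃ p : ℕ, p.Prime ∧ 3 ≤ p ∧ p ∣ Nat.card N
  · obtain ⟨p, hp, h3, hdvd⟩ := hp
    have : Fact p.Prime := ⟨hp⟩
    obtain ⟨g, hg⟩ := exists_prime_orderOf_dvd_card' p hdvd
    have hg' : orderOf (g : H) = p := by rw [Subgroup.orderOf_coe, hg]
    rcases h3.eq_or_lt with rfl | h3
    · exact hN.commute_of_orderOf_three hH g.2 hg'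
    · refine hN.commute_of_five_le hH hp ?_ g.2 hg'
      by_contra h5
      have : p = 4 := by omega
      subst this
      exact absurd hp (by norm_num)
  · push Not at hp
    have h2 : IsPGroup 2 N := by
      refine IsPGroup.of_card (n := (Nat.card N).primeFactorsList.length) ?_
      refine Nat.eq_prime_pow_of_unique_prime_dvd Nat.card_pos.ne' ?_
      intro d hd hdvd
      by_contra h
      exact hp d hd (by have := hd.two_le; omega) hdvd
    have : Fact (Nat.Prime 2) := ⟨Nat.prime_two⟩
    have hnt : Nontrivial N := (Subgroup.nontrivial_iff_ne_bot N).2 hN.ne_bot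
    have hc := h2.center_nontrivial
    have hnorm := hN.normal
    rcases hN.eq_bot_or_eq (Subgroup.centralizer N ⊓ N) inferInstance inf_le_right with h | h
    · exfalso
      obtain ⟨z, hz⟩ := exists_ne (1 : Subgroup.center N)
      apply hz
      have hz' : ((z : N) : H) ∈ Subgroup.centralizer N ⊓ N := by
        refine Subgroup.mem_inf.2 ⟨?_, z.1.2⟩
        rw [Subgroup.mem_centralizer_iff]
        intro n hn
        have := Subgroup.mem_center_iff.1 z.2 ⟨n, hn⟩
        exact congrArg Subtype.val this
      rw [h, Subgroup.mem_bot] at hz'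
      exact Subtype.ext (Subtype.ext hz')
    · intro x hx y hy
      have hy' : y ∈ Subgroup.centralizer N ⊓ N := h.symm ▸ hy
      exact Subgroup.mem_centralizer_iff.1 hy'.1 x hx

/-- The terms of normal series with cyclic factors starting at the trivial subgroup. -/
inductive CyclicTower {G : Type*} [Group G] : Subgroup G → Prop
  | bot : CyclicTower ⊥
  | step (K : Subgroup G) (x : G) : CyclicTower K → (K ⊔ Subgroup.zpowers x).Normal →
      CyclicTower (K ⊔ Subgroup.zpowers x)

theorem CyclicTower.normal {G : Type*} [Group G] {K : Subgroup G} (hK : CyclicTower K) :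
    K.Normal := by
  cases hK with
  | bot => infer_instance
  | step K x _ h => exact h

theorem CyclicTower.exists_series {G : Type*} [Group G] {K : Subgroup G} (hK : CyclicTower K) :
    ∃ (n : ℕ) (s : Fin (n + 1) → Subgroup G),
      s 0 = ⊥ ∧ s (Fin.last n) = K ∧ (∀ i : Fin (n + 1), (s i).Normal) ∧
      ∀ i : Fin n, ∃ x : G, s i.succ = s i.castSucc ⊔ Subgroup.zpowers x := by
  induction hK with
  | bot => exact ⟨0, fun _ => ⊥, rfl, rfl, fun _ => inferInstance, fun i => i.elim0⟩
  | step K x _ hnorm ih =>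
    obtain ⟨n, s, h0, hl, hn, hs⟩ := ih
    refine ⟨n + 1, Fin.snoc (α := fun _ => Subgroup G) s (K ⊔ Subgroup.zpowers x), ?_, ?_, ?_, ?_⟩
    · rw [← Fin.castSucc_zero, Fin.snoc_castSucc, h0]
    · rw [Fin.snoc_last]
    · intro i
      induction i using Fin.lastCases with
      | last => rwa [Fin.snoc_last]
      | cast i => rw [Fin.snoc_castSucc]; exact hn i
    · intro i
      induction i using Fin.lastCases with
      | last => exact ⟨x, by rw [Fin.succ_last, Fin.snoc_last, Fin.snoc_castSucc, hl]⟩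
      | cast i =>
        obtain ⟨y, hy⟩ := hs i
        exact ⟨y, by rw [Fin.succ_castSucc, Fin.snoc_castSucc, Fin.snoc_castSucc, hy]⟩

theorem exists_isMinNormal (H : Type*) [Group H] [Finite H] [Nontrivial H] :
    ∃ V : Subgroup H, IsMinNormal V := by
  obtain ⟨V, hV⟩ := (Set.toFinite {N : Subgroup H | N.Normal ∧ N ≠ ⊥}).exists_minimal
    ⟨⊤, inferInstance, top_ne_bot⟩
  refine ⟨V, hV.prop.1, hV.prop.2, fun L hL hLV => ?_⟩
  by_cases h : L = ⊥
  · exact Or.inl h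
  · exact Or.inr (le_antisymm hLV (hV.le_of_le ⟨hL, h⟩ hLV))

/-- A finite group that is not supersolvable has a noncyclic chief factor. -/
theorem exists_isMinNormal_ne_zpowers {G : Type*} [Group G] [Finite G] (h : ¬ IsSupersolvable G) :
    ∃ (K : Subgroup G) (_ : K.Normal) (V : Subgroup (G ⧸ K)),
      IsMinNormal V ∧ ∀ v, V ≠ Subgroup.zpowers v := by
  obtain ⟨K, hK⟩ := (Set.toFinite {K : Subgroup G | CyclicTower K}).exists_maximal
    ⟨⊥, CyclicTower.bot⟩
  have hnorm : K.Normal := hK.prop.normal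
  have htop : K ≠ ⊤ := by
    rintro rfl
    exact h hK.prop.exists_series
  have : Nontrivial (G ⧸ K) := by
    by_contra hn
    exact htop (QuotientGroup.subgroup_eq_top_of_subsingleton K (not_nontrivial_iff_subsingleton.1 hn))
  obtain ⟨V, hV⟩ := exists_isMinNormal (G ⧸ K)
  refine ⟨K, hnorm, V, hV, fun v hv => ?_⟩
  obtain ⟨x, rfl⟩ := QuotientGroup.mk_surjective v
  have hc : V.comap (QuotientGroup.mk' K) = K ⊔ Subgroup.zpowers x := by
    rw [hv, show Subgroup.zpowers (x : G ⧸ K) = (Subgroup.zpowers x).map (QuotientGroup.mk' K) from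
      (MonoidHom.map_zpowers (QuotientGroup.mk' K) x).symm, Subgroup.comap_map_eq,
      QuotientGroup.ker_mk', sup_comm]
  have hVn := hV.normal
  have hle := hK.le_of_ge (CyclicTower.step K x hK.prop (hc ▸ inferInstance)) le_sup_left
  have hx : x ∈ K := hle (Subgroup.mem_sup_right (Subgroup.mem_zpowers x))
  apply hV.ne_bot
  rw [hv, Subgroup.zpowers_eq_bot]
  exact (QuotientGroup.eq_one_iff x).2 hx

theorem sqOne_subset_preimage {G : Type*} [Group G] (K : Subgroup G) [K.Normal] :
    sqOne G ⊆ (QuotientGroup.mk ⁻¹' sqOne (G ⧸ K) : Set G) := by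
  intro x hx
  rw [Set.mem_preimage, mem_sqOne, ← QuotientGroup.mk_mul, mem_sqOne.1 hx, QuotientGroup.mk_one]

theorem ncard_preimage_mk {G : Type*} [Group G] (K : Subgroup G) (S : Set (G ⧸ K)) :
    (QuotientGroup.mk ⁻¹' S : Set G).ncard = Nat.card K * S.ncard := by
  rw [← Nat.card_coe_set_eq, QuotientGroup.card_preimage_mk, Nat.card_coe_set_eq]

theorem ncard_sqOne_le {G : Type*} [Group G] [Finite G] (K : Subgroup G) [K.Normal] :
    (sqOne G).ncard ≤ Nat.card K * (sqOne (G ⧸ K)).ncard := by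
  rw [← ncard_preimage_mk]
  exact Set.ncard_le_ncard (sqOne_subset_preimage K)

theorem five_card_le_quotient {G : Type*} [Group G] [Finite G] (K : Subgroup G) [K.Normal]
    (h : 5 * Nat.card G ≤ 12 * (sqOne G).ncard) :
    5 * Nat.card (G ⧸ K) ≤ 12 * (sqOne (G ⧸ K)).ncard := by
  have h1 := ncard_sqOne_le K
  rw [Subgroup.card_eq_card_quotient_mul_card_subgroup K] at h
  have hpos : 0 < Nat.card K := Nat.card_pos
  refine Nat.le_of_mul_le_mul_left ?_ hpos
  nlinarith

/-- The elements of a coset of `C` whose square is trivial. -/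
def sqOneFiber {H : Type*} [Group H] (C : Subgroup H) (q : H ⧸ C) : Set H :=
  {t | t * t = 1 ∧ (t : H ⧸ C) = q}

theorem sum_ncard_sqOneFiber {H : Type*} [Group H] [Finite H] (C : Subgroup H)
    [Fintype (H ⧸ C)] : ∑ q, (sqOneFiber C q).ncard = (sqOne H).ncard := by
  have : Fintype H := Fintype.ofFinite H
  have h1 : (sqOne H).ncard = ({t | t * t = 1} : Finset H).card := by
    rw [← Set.ncard_coe_finset]; congr 1; ext; simp [mem_sqOne]
  rw [h1, Finset.card_eq_sum_card_fiberwise (f := fun t : H => (t : H ⧸ C)) (t := Finset.univ)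
    (fun _ _ => Finset.mem_coe.2 (Finset.mem_univ _))]
  refine Finset.sum_congr rfl fun q _ => ?_
  rw [← Set.ncard_coe_finset]
  congr 1
  ext t
  simp [sqOneFiber]

theorem ncard_coset {H : Type*} [Group H] (C : Subgroup H) (q : H ⧸ C) :
    (QuotientGroup.mk ⁻¹' {q} : Set H).ncard = Nat.card C := by
  rw [ncard_preimage_mk, Set.ncard_singleton, mul_one]

theorem ncard_sqOneFiber_le {H : Type*} [Group H] [Finite H] (C : Subgroup H) (q : H ⧸ C) :
    (sqOneFiber C q).ncard ≤ Nat.card C := by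
  rw [← ncard_coset C q]
  exact Set.ncard_le_ncard fun t ht => ht.2

theorem sqOneFiber_eq_empty {H : Type*} [Group H] (C : Subgroup H) [C.Normal] {q : H ⧸ C}
    (hq : q * q ≠ 1) : sqOneFiber C q = ∅ := by
  rw [Set.eq_empty_iff_forall_notMem]
  rintro t ⟨ht, rfl⟩
  exact hq (by rw [← QuotientGroup.mk_mul, ht, QuotientGroup.mk_one])

/-- If the translates of a subset of a coset by the first `r` powers of an element are disjoint,
then the subset fills at most `1/r` of the coset. -/
theorem mul_ncard_le_of_mul_pow_notMem {H : Type*} [Group H] [Finite H] (C : Subgroup H)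
    {q : H ⧸ C} {S : Set H} (hS : ∀ t ∈ S, (t : H ⧸ C) = q) {v : H} (hv : v ∈ C) (r : ℕ)
    (h : ∀ t ∈ S, ∀ k, 0 < k → k < r → t * v ^ k ∉ S) : r * S.ncard ≤ Nat.card C := by
  have key : ∀ t ∈ S, ∀ t' ∈ S, ∀ i j : ℕ, i < r → j ≤ i → t * v ^ i = t' * v ^ j → i = j := by
    intro t ht t' ht' i j hi hji he
    by_contra hne
    apply h t ht (i - j) (by omega) (by omega)
    have : t * v ^ (i - j) = t' := by
      have : v ^ i = v ^ (i - j) * v ^ j := by rw [← pow_add]; congr 1; omega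
      rw [this, ← mul_assoc] at he
      exact mul_right_cancel he
    rwa [this]
  let f : Fin r × S → (QuotientGroup.mk ⁻¹' {q} : Set H) := fun x => ⟨x.2 * v ^ (x.1 : ℕ), by
    rw [Set.mem_preimage, Set.mem_singleton_iff, ← hS _ x.2.2, eq_comm, QuotientGroup.eq,
      inv_mul_cancel_left]
    exact pow_mem hv _⟩
  have hf : Function.Injective f := by
    rintro ⟨i, t, ht⟩ ⟨j, t', ht'⟩ he
    have he : t * v ^ (i : ℕ) = t' * v ^ (j : ℕ) := congrArg Subtype.val he
    have hij : i = j := by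
      rcases le_total (j : ℕ) i with hle | hle
      · exact Fin.ext (key t ht t' ht' i j i.2 hle he)
      · exact Fin.ext (key t' ht' t ht j i j.2 hle he.symm).symm
    subst hij
    exact Prod.ext rfl (Subtype.ext (mul_right_cancel he))
  have := Nat.card_le_card_of_injective f hf
  rwa [Nat.card_prod, Nat.card_fin, Nat.card_coe_set_eq, Nat.card_coe_set_eq, ncard_coset] at this

theorem Subgroup.eq_top_of_card_lt_two_mul {Q : Type*} [Group Q] [Finite Q] {L : Subgroup Q}
    {S : Set Q} (hS : S ⊆ L) (h : Nat.card Q < 2 * S.ncard) : L = ⊤ := by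
  have h1 : S.ncard ≤ Nat.card L := by
    rw [← Nat.card_coe_set_eq]
    exact Nat.card_mono (Set.toFinite _) hS
  have h2 := L.index_mul_card
  have h3 : L.index ≠ 0 := Subgroup.index_ne_zero_of_finite
  rw [← Subgroup.index_eq_one]
  by_contra h4
  have : 2 ≤ L.index := by omega
  nlinarith

/-- A finite group in which more than `3/4` of the elements square to `1` has exponent `2`. -/
theorem mul_self_eq_one_of_three_mul_card_lt {Q : Type*} [Group Q] [Finite Q]
    (h : 3 * Nat.card Q < 4 * (sqOne Q).ncard) (x : Q) : x * x = 1 := by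
  have hcent : sqOne Q ⊆ Subgroup.center Q := by
    intro t ht
    have htop : Subgroup.centralizer {t} = ⊤ := by
      refine Subgroup.eq_top_of_card_lt_two_mul (S := sqOne Q ∩ (t * ·) ⁻¹' sqOne Q) ?_ ?_
      · rintro y ⟨hy, hty⟩
        rw [SetLike.mem_coe, Subgroup.mem_centralizer_singleton_iff]
        have h1 : t * y * (t * y) = 1 := hty
        have h2 : t⁻¹ = t := inv_eq_of_mul_eq_one_right ht
        have h3 : y⁻¹ = y := inv_eq_of_mul_eq_one_right hy
        have h4 := inv_eq_of_mul_eq_one_right h1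
        rw [mul_inv_rev, h2, h3] at h4
        exact h4
      · have h1 : ((t * ·) ⁻¹' sqOne Q).ncard = (sqOne Q).ncard :=
          Set.ncard_preimage_of_injective_subset_range (mul_right_injective t)
            fun y _ => ⟨t⁻¹ * y, by simp⟩
        have h2 := Set.ncard_union_add_ncard_inter (sqOne Q) ((t * ·) ⁻¹' sqOne Q)
        have h3 : (sqOne Q ∪ (t * ·) ⁻¹' sqOne Q).ncard ≤ Nat.card Q := Set.ncard_le_card _
        omega
    rw [SetLike.mem_coe, Subgroup.mem_center_iff]
    intro y
    have : y ∈ Subgroup.centralizer {t} := htop ▸ Subgroup.mem_top y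
    exact Subgroup.mem_centralizer_singleton_iff.1 this
  have hctop := Subgroup.eq_top_of_card_lt_two_mul hcent (by omega)
  have hcomm : ∀ y z : Q, y * z = z * y := fun y z =>
    Subgroup.mem_center_iff.1 (hctop ▸ Subgroup.mem_top z : z ∈ Subgroup.center Q) y
  let L : Subgroup Q :=
    { carrier := sqOne Q
      one_mem' := mul_one 1
      mul_mem' := by
        intro a b ha hb
        rw [mem_sqOne] at *
        rw [mul_assoc, hcomm b, mul_assoc, hb, mul_one, ha]
      inv_mem' := by
        intro a ha
        rw [mem_sqOne] at *
        rw [← mul_inv_rev, ha, inv_one] }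
  have hL := Subgroup.eq_top_of_card_lt_two_mul (L := L) (S := sqOne Q) subset_rfl (by omega)
  exact (hL ▸ Subgroup.mem_top x : x ∈ L)

theorem ncard_sqOne_add_two_le {Q : Type*} [Group Q] [Finite Q] {q : Q} (hq : q * q ≠ 1) :
    (sqOne Q).ncard + 2 ≤ Nat.card Q := by
  have hne : q ≠ q⁻¹ := fun h => hq (by nth_rw 2 [h]; exact mul_inv_cancel q)
  have hq' : q⁻¹ * q⁻¹ ≠ 1 := fun h => hq (by rwa [← mul_inv_rev, inv_eq_one] at h)
  have hdisj : Disjoint (sqOne Q) {q, q⁻¹} := by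
    rw [Set.disjoint_right]
    rintro x (rfl | rfl)
    exacts [hq, hq']
  rw [← Set.ncard_pair hne, ← Set.ncard_union_eq hdisj]
  exact Set.ncard_le_card _

theorem card_modEq_ncard_sqOne {Q : Type*} [Group Q] [Finite Q] :
    Nat.card Q ≡ (sqOne Q).ncard [MOD 2] := by
  have : Fintype Q := Fintype.ofFinite Q
  have : Fact (Nat.Prime 2) := ⟨Nat.prime_two⟩
  have h := Equiv.Perm.card_fixedPoints_modEq (f := (fun x : Q => x⁻¹ : Function.End Q))
    (p := 2) (n := 1) (by
      rw [pow_one]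
      exact (pow_two (M := Function.End Q) _).trans (funext fun x => inv_inv x))
  rw [← Nat.card_eq_fintype_card, ← Nat.card_eq_fintype_card] at h
  have h1 : Function.fixedPoints (fun x : Q => x⁻¹) = sqOne Q := by
    ext x
    rw [Function.mem_fixedPoints, Function.IsFixedPt, mem_sqOne, inv_eq_iff_mul_eq_one]
  rwa [h1, Nat.card_coe_set_eq] at h

theorem ncard_sqOne_of_odd {Q : Type*} [Group Q] [Finite Q] (h : Odd (Nat.card Q)) :
    (sqOne Q).ncard = 1 := by
  rw [Set.ncard_eq_one]
  refine ⟨1, ?_⟩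
  ext x
  rw [mem_sqOne, Set.mem_singleton_iff]
  refine ⟨fun hx => ?_, fun hx => by rw [hx, mul_one]⟩
  rw [← orderOf_eq_one_iff]
  have h2 : orderOf x ∣ 2 := orderOf_dvd_of_pow_eq_one (by rw [pow_two, hx])
  have h3 : orderOf x ∣ Nat.card Q := orderOf_dvd_natCard x
  exact Nat.eq_one_of_dvd_coprimes (Nat.coprime_two_left.2 h) h2 h3

theorem card_eq_six_of_bounds {Q : Type*} [Group Q] [Finite Q]
    (h2 : ¬ IsPGroup 2 Q) (h : 5 * Nat.card Q ≤ 6 * (sqOne Q).ncard + 6) :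
    Nat.card Q = 6 := by
  have hex : ∃ q : Q, q * q ≠ 1 := by
    by_contra hall
    push Not at hall
    exact h2 fun g => ⟨1, by rw [pow_one, pow_two, hall]⟩
  obtain ⟨q, hq⟩ := hex
  have h3 : 4 * (sqOne Q).ncard ≤ 3 * Nat.card Q := by
    by_contra hlt
    exact hq (mul_self_eq_one_of_three_mul_card_lt (by omega) q)
  have h4 := ncard_sqOne_add_two_le hq
  have h5 := card_modEq_ncard_sqOne (Q := Q)
  unfold Nat.ModEq at h5
  have h8 : Nat.card Q ≠ 8 := fun h8 => h2 (IsPGroup.of_card (n := 3) (by rw [h8]; norm_num))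
  rcases Nat.even_or_odd (Nat.card Q) with he | ho
  · obtain ⟨k, hk⟩ := he
    have : k ≤ 6 := by omega
    interval_cases k <;> omega
  · have := ncard_sqOne_of_odd ho
    omega

theorem IsMinNormal.exists_prime_pow_eq_one {H : Type*} [Group H] [Finite H] {V : Subgroup H}
    (hV : IsMinNormal V) (hab : ∀ x ∈ V, ∀ y ∈ V, x * y = y * x) :
    ∃ p : ℕ, p.Prime ∧ ∀ v ∈ V, v ^ p = 1 := by
  have hnorm := hV.normal
  obtain ⟨p, hp, hdvd⟩ := Nat.exists_prime_and_dvd (n := Nat.card V)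
    (fun h => hV.ne_bot (Subgroup.card_eq_one.1 h))
  have : Fact p.Prime := ⟨hp⟩
  obtain ⟨g, hg⟩ := exists_prime_orderOf_dvd_card' p hdvd
  let L : Subgroup H :=
    { carrier := {x | x ∈ V ∧ x ^ p = 1}
      one_mem' := ⟨one_mem V, one_pow p⟩
      mul_mem' := fun {a b} ha hb => ⟨mul_mem ha.1 hb.1, by
        rw [(show Commute a b from hab a ha.1 b hb.1).mul_pow, ha.2, hb.2, one_mul]⟩
      inv_mem' := fun {a} ha => ⟨inv_mem ha.1, by rw [inv_pow, ha.2, inv_one]⟩ }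
  have hL : L.Normal := ⟨fun a ha g => ⟨hnorm.conj_mem a ha.1 g, by
    rw [conj_pow, ha.2, mul_one, mul_inv_cancel]⟩⟩
  refine ⟨p, hp, fun v hv => ?_⟩
  rcases hV.eq_bot_or_eq L hL (fun x hx => hx.1) with h | h
  · exfalso
    have h1 : (g : H) ∈ L := ⟨g.2, by
      rw [← Subgroup.coe_pow, ← hg, pow_orderOf_eq_one, Subgroup.coe_one]⟩
    rw [h, Subgroup.mem_bot, OneMemClass.coe_eq_one] at h1
    rw [h1, orderOf_one] at hg
    exact hp.one_lt.ne hg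
  · exact (h.symm ▸ hv : v ∈ L).2

theorem conj_eq_inv_of_conj_pow_eq_inv {H : Type*} [Group H] {p k : ℕ} (hp : p.Prime) {t v : H}
    (hv : v ^ p = 1) (hk : 0 < k) (hkp : k < p) (h : t * v ^ k * t⁻¹ = (v ^ k)⁻¹) :
    t * v * t⁻¹ = v⁻¹ := by
  have hc : k.Coprime (orderOf v) :=
    Nat.Coprime.coprime_dvd_right (orderOf_dvd_of_pow_eq_one hv)
      (Nat.coprime_of_lt_prime hk.ne' hkp hp).symm
  obtain ⟨m, hm⟩ := exists_pow_eq_self_of_coprime hc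
  rw [← hm, ← conj_pow, h, inv_pow]

theorem mul_ncard_sqOneFiber_le {H : Type*} [Group H] [Finite H] (C : Subgroup H) {p r : ℕ}
    (hp : p.Prime) (hr : r ≤ p) {v : H} (hv : v ^ p = 1) (hvC : v ∈ C)
    (hC : ∀ c ∈ C, c * v * c⁻¹ = v) {h : H} (hh : h * v * h⁻¹ ≠ v⁻¹) :
    r * (sqOneFiber C (h : H ⧸ C)).ncard ≤ Nat.card C := by
  refine mul_ncard_le_of_mul_pow_notMem C (fun t ht => ht.2) hvC r ?_
  rintro t ⟨ht, htq⟩ k hk hkr ⟨hk', -⟩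
  apply hh
  have h1 : t * v ^ k * t⁻¹ = (v ^ k)⁻¹ := by
    have h2 : t⁻¹ = t := inv_eq_of_mul_eq_one_right ht
    rw [h2, eq_inv_iff_mul_eq_one, mul_assoc, hk']
  have h2 := conj_eq_inv_of_conj_pow_eq_inv hp hv hk (by omega) h1
  have h3 : h⁻¹ * t ∈ C := QuotientGroup.eq.1 htq.symm
  have h4 := hC _ h3
  rw [← h2]
  nth_rw 1 [← h4]
  group

theorem IsMinNormal.eq_zpowers {H : Type*} [Group H] {V : Subgroup H} (hV : IsMinNormal V) {v : H}
    (hv : v ∈ V) (hv1 : v ≠ 1) (h : ∀ x : H, x * v * x⁻¹ ∈ Subgroup.zpowers v) :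
    V = Subgroup.zpowers v := by
  have hn : (Subgroup.zpowers v).Normal := by
    refine ⟨?_⟩
    rintro _ ⟨k, rfl⟩ x
    change x * v ^ k * x⁻¹ ∈ _
    rw [← conj_zpow]
    exact zpow_mem (h x) k
  rcases hV.eq_bot_or_eq _ hn (by rwa [Subgroup.zpowers_le]) with h' | h'
  · exact absurd (Subgroup.zpowers_eq_bot.1 h') hv1
  · exact h'.symm

theorem mem_centralizer_of_conj {H : Type*} [Group H] {V : Subgroup H} {x : H} :
    x ∈ Subgroup.centralizer (V : Set H) ↔ ∀ v ∈ V, x * v * x⁻¹ = v := by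
  rw [Subgroup.mem_centralizer_iff]
  refine forall₂_congr fun v _ => ?_
  rw [mul_inv_eq_iff_eq_mul, eq_comm]

theorem IsMinNormal.eq_zpowers_of_isPGroup {H : Type*} [Group H] [Finite H] {V : Subgroup H}
    (hV : IsMinNormal V) (hV2 : ∀ v ∈ V, v ^ 2 = 1)
    (hQ : haveI := hV.normal; IsPGroup 2 (H ⧸ Subgroup.centralizer (V : Set H))) :
    ∃ v, V = Subgroup.zpowers v := by
  have hnorm := hV.normal
  have : Fact (Nat.Prime 2) := ⟨Nat.prime_two⟩
  let f : H →* MulAut V := MulAut.conjNormal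
  have hf : IsPGroup 2 f.range := by
    rintro ⟨_, x, rfl⟩
    obtain ⟨k, hk⟩ := hQ (x : H ⧸ Subgroup.centralizer (V : Set H))
    refine ⟨k, Subtype.ext ?_⟩
    rw [Subgroup.coe_pow, Subgroup.coe_one, ← map_pow]
    have h1 := mem_centralizer_of_conj.1 ((QuotientGroup.eq_one_iff (x ^ 2 ^ k)).1 hk)
    ext v
    rw [MulAut.conjNormal_apply, h1 v v.2, MulAut.one_apply]
  have hnt : Nontrivial V := (Subgroup.nontrivial_iff_ne_bot V).2 hV.ne_bot
  have hdvd : 2 ∣ Nat.card V := by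
    obtain ⟨v, hv⟩ := exists_ne (1 : V)
    have : orderOf v = 2 := orderOf_eq_prime (Subtype.ext (hV2 v v.2)) hv
    rw [← this]
    exact orderOf_dvd_natCard v
  have h1 : (1 : V) ∈ MulAction.fixedPoints f.range V := fun g => map_one g.1
  obtain ⟨b, hb, hb1⟩ := hf.exists_fixed_point_of_prime_dvd_card_of_fixed_point V hdvd h1
  refine ⟨b, hV.eq_zpowers b.2 (fun h => hb1 (Subtype.ext h.symm)) fun x => ?_⟩
  have h2 : f x b = b := hb ⟨f x, x, rfl⟩
  have h3 : x * b * x⁻¹ = (b : H) := by rw [← MulAut.conjNormal_apply]; exact congrArg Subtype.val h2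
  rw [h3]
  exact Subgroup.mem_zpowers _

theorem IsMinNormal.eq_zpowers_of_mul_self_mem {H : Type*} [Group H] {V : Subgroup H}
    (hV : IsMinNormal V) (hab : ∀ x ∈ V, ∀ y ∈ V, x * y = y * x)
    (hQ : ∀ x : H, x * x ∈ Subgroup.centralizer (V : Set H)) :
    ∃ v, V = Subgroup.zpowers v := by
  have hnorm := hV.normal
  obtain ⟨v, hv, hv1⟩ := V.bot_or_exists_ne_one.resolve_left hV.ne_bot
  refine ⟨v, hV.eq_zpowers hv hv1 fun x => ?_⟩
  have hcomm : ∀ y : H, x⁻¹ * y⁻¹ * x * y ∈ Subgroup.centralizer (V : Set H) := by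
    intro y
    have h1 : ∀ z : H, (z : H ⧸ Subgroup.centralizer (V : Set H)) * z = 1 := fun z =>
      (QuotientGroup.eq_one_iff (z * z)).2 (hQ z)
    rw [← QuotientGroup.eq_one_iff]
    have h2 := h1 (x⁻¹ * y⁻¹)
    have h3 : ∀ z : H, ((z⁻¹ : H) : H ⧸ Subgroup.centralizer (V : Set H)) = z := fun z => by
      rw [QuotientGroup.mk_inv]; exact inv_eq_of_mul_eq_one_right (h1 z)
    rw [QuotientGroup.mk_mul, QuotientGroup.mk_mul, QuotientGroup.mk_mul, h3, h3]
    rw [QuotientGroup.mk_mul, h3, h3, ← mul_assoc] at h2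
    exact h2
  let F : Subgroup H :=
    { carrier := {w | w ∈ V ∧ x * w * x⁻¹ = w}
      one_mem' := ⟨one_mem V, by group⟩
      mul_mem' := fun {a b} ha hb => ⟨mul_mem ha.1 hb.1, by
        rw [← conj_mul, ha.2, hb.2]⟩
      inv_mem' := fun {a} ha => ⟨inv_mem ha.1, by rw [← conj_inv, ha.2]⟩ }
  have hF : F.Normal := ⟨fun w hw y => ⟨hnorm.conj_mem w hw.1 y, by
    have h1 := mem_centralizer_of_conj.1 (hcomm y) w hw.1
    calc x * (y * w * y⁻¹) * x⁻¹
        = y * (x * (x⁻¹ * y⁻¹ * x * y * w * (x⁻¹ * y⁻¹ * x * y)⁻¹) * x⁻¹) * y⁻¹ := by group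
      _ = y * w * y⁻¹ := by rw [h1, hw.2]⟩⟩
  rcases hV.eq_bot_or_eq F hF (fun w hw => hw.1) with h | h
  · have h1 : v * (x * v * x⁻¹) ∈ F := by
      have hc := hnorm.conj_mem v hv x
      refine ⟨mul_mem hv hc, ?_⟩
      have h2 := mem_centralizer_of_conj.1 (hQ x) v hv
      have h3 : x * (x * v * x⁻¹) * x⁻¹ = v := by
        rw [← mul_assoc, ← mul_assoc, mul_assoc _ x⁻¹ x⁻¹, ← mul_inv_rev, h2]
      rw [← conj_mul, h3, hab _ hc _ hv]
    rw [h, Subgroup.mem_bot] at h1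
    rw [← inv_eq_of_mul_eq_one_right h1]
    exact inv_mem (Subgroup.mem_zpowers _)
  · have h1 : v ∈ F := h.symm ▸ hv
    rw [h1.2]
    exact Subgroup.mem_zpowers _

theorem sum_ite_mul_self (Q : Type*) [Group Q] [Fintype Q]
    [DecidablePred fun q : Q => q * q = 1] :
    ∑ q : Q, (if q * q = 1 then 1 else 0) = (sqOne Q).ncard := by
  rw [Finset.sum_boole, Nat.cast_id, ← Set.ncard_coe_finset]
  congr 1
  ext; simp [mem_sqOne]

theorem IsMinNormal.eq_zpowers_of_three_le {H : Type*} [Group H] [Finite H] {V : Subgroup H}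
    (hV : IsMinNormal V) (hab : ∀ x ∈ V, ∀ y ∈ V, x * y = y * x)
    (hH : 5 * Nat.card H ≤ 12 * (sqOne H).ncard) {p : ℕ} (hp : p.Prime) (h3 : 3 ≤ p)
    (hVp : ∀ v ∈ V, v ^ p = 1) : ∃ v, V = Subgroup.zpowers v := by
  have hnorm := hV.normal
  set C := Subgroup.centralizer (V : Set H) with hC
  have hVC : V ≤ C := fun x hx => Subgroup.mem_centralizer_iff.2 fun y hy => hab y hy x hx
  have hQ : ∀ q : H ⧸ C, q * q = 1 := by
    by_contra hex
    push Not at hex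
    obtain ⟨q₁, hq₁⟩ := hex
    have h1 := ncard_sqOne_add_two_le hq₁
    have : Fintype (H ⧸ C) := Fintype.ofFinite _
    let I : H ⧸ C → Prop := fun q => ∃ h : H, (h : H ⧸ C) = q ∧ ∀ v ∈ V, h * v * h⁻¹ = v⁻¹
    have h2 : ∀ q : H ⧸ C, 3 * (sqOneFiber C q).ncard ≤
        Nat.card C * (if q * q = 1 then 1 else 0) + 2 * Nat.card C * (if I q then 1 else 0) := by
      intro q
      by_cases hq : q * q = 1
      · by_cases hI : I q
        · have := ncard_sqOneFiber_le C q
          rw [if_pos hq, if_pos hI]; omega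
        · rw [if_pos hq, if_neg hI, mul_one, mul_zero, add_zero]
          obtain ⟨h, rfl⟩ := QuotientGroup.mk_surjective q
          have : ∃ v ∈ V, h * v * h⁻¹ ≠ v⁻¹ := by
            by_contra hall
            push Not at hall
            exact hI ⟨h, rfl, hall⟩
          obtain ⟨v, hv, hvh⟩ := this
          exact mul_ncard_sqOneFiber_le C hp h3 (hVp v hv) (hVC hv)
            (fun c hc => mem_centralizer_of_conj.1 hc v hv) hvh
      · rw [sqOneFiber_eq_empty C hq, Set.ncard_empty, mul_zero]
        exact Nat.zero_le _
    have h4 := Finset.sum_le_sum fun q (_ : q ∈ Finset.univ) => h2 q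
    rw [← Finset.mul_sum, sum_ncard_sqOneFiber, Finset.sum_add_distrib, ← Finset.mul_sum,
      ← Finset.mul_sum, sum_ite_mul_self, Finset.sum_boole, Nat.cast_id] at h4
    have h5 : (Finset.univ.filter I).card ≤ 1 := by
      rw [Finset.card_le_one]
      intro a ha b hb
      obtain ⟨x, rfl, hx⟩ := (Finset.mem_filter.1 ha).2
      obtain ⟨y, rfl, hy⟩ := (Finset.mem_filter.1 hb).2
      rw [QuotientGroup.eq, hC, mem_centralizer_of_conj]
      intro v hv
      have e1 : y * v * y⁻¹ = x * v * x⁻¹ := by rw [hx v hv, hy v hv]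
      calc x⁻¹ * y * v * (x⁻¹ * y)⁻¹ = x⁻¹ * (y * v * y⁻¹) * x := by group
        _ = v := by rw [e1]; group
    rw [Subgroup.card_eq_card_quotient_mul_card_subgroup C] at hH
    have hpos : 0 < Nat.card C := Nat.card_pos
    have h6 : 5 * Nat.card (H ⧸ C) ≤ 4 * ((sqOne (H ⧸ C)).ncard + 2) := by
      refine Nat.le_of_mul_le_mul_left ?_ hpos
      nlinarith
    have h7 : (0 : ℕ) < Nat.card (H ⧸ C) := Nat.card_pos
    omega
  exact hV.eq_zpowers_of_mul_self_mem hab fun x => (QuotientGroup.eq_one_iff _).1 (hQ x)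

/-- The structure of a noncyclic minimal normal subgroup of a group in which at least `5/12` of
the elements square to `1`. -/
theorem IsMinNormal.centralizer_of_ne_zpowers {H : Type*} [Group H] [Finite H] {V : Subgroup H}
    (hV : IsMinNormal V) (hne : ∀ v, V ≠ Subgroup.zpowers v)
    (hH : 5 * Nat.card H ≤ 12 * (sqOne H).ncard) :
    V ≤ Subgroup.centralizer (V : Set H) ∧ (Subgroup.centralizer (V : Set H)).index = 6 ∧
      (∀ c ∈ Subgroup.centralizer (V : Set H), c * c = 1) ∧
      12 * (sqOne H).ncard ≤ 5 * Nat.card H := by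
  have hnorm := hV.normal
  have hab := hV.commute hH
  obtain ⟨p, hp, hVp⟩ := hV.exists_prime_pow_eq_one hab
  have hp2 : p = 2 := by
    by_contra h
    obtain ⟨v, hv⟩ := hV.eq_zpowers_of_three_le hab hH hp (by have := hp.two_le; omega) hVp
    exact hne v hv
  subst hp2
  set C := Subgroup.centralizer (V : Set H) with hC
  have hVC : V ≤ C := fun x hx => Subgroup.mem_centralizer_iff.2 fun y hy => hab y hy x hx
  have hQ : ¬ IsPGroup 2 (H ⧸ C) := fun h => by
    obtain ⟨v, hv⟩ := hV.eq_zpowers_of_isPGroup hVp h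
    exact hne v hv
  have : Fintype (H ⧸ C) := Fintype.ofFinite _
  have h2 : ∀ q : H ⧸ C, q ≠ 1 → 2 * (sqOneFiber C q).ncard ≤
      Nat.card C * (if q * q = 1 then 1 else 0) := by
    intro q hq1
    by_cases hq : q * q = 1
    · rw [if_pos hq, mul_one]
      obtain ⟨h, rfl⟩ := QuotientGroup.mk_surjective q
      have : ∃ v ∈ V, h * v * h⁻¹ ≠ v⁻¹ := by
        by_contra hall
        push Not at hall
        refine hq1 ((QuotientGroup.eq_one_iff h).2 (mem_centralizer_of_conj.2 fun v hv => ?_))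
        rw [hall v hv, inv_eq_iff_mul_eq_one, ← pow_two, hVp v hv]
      obtain ⟨v, hv, hvh⟩ := this
      exact mul_ncard_sqOneFiber_le C hp le_rfl (hVp v hv) (hVC hv)
        (fun c hc => mem_centralizer_of_conj.1 hc v hv) hvh
    · rw [sqOneFiber_eq_empty C hq, Set.ncard_empty, mul_zero]
      exact Nat.zero_le _
  have h4 := Finset.sum_le_sum fun q (hq : q ∈ Finset.univ.erase (1 : H ⧸ C)) =>
    h2 q (Finset.ne_of_mem_erase hq)
  rw [← Finset.mul_sum, ← Finset.mul_sum] at h4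
  have h5 := Finset.add_sum_erase Finset.univ (fun q : H ⧸ C => (sqOneFiber C q).ncard)
    (Finset.mem_univ 1)
  rw [sum_ncard_sqOneFiber] at h5
  have h6 := Finset.add_sum_erase Finset.univ (fun q : H ⧸ C => if q * q = 1 then 1 else 0)
    (Finset.mem_univ 1)
  rw [sum_ite_mul_self] at h6
  simp only [mul_one, if_true] at h6
  have h7 := ncard_sqOneFiber_le C 1
  have hpos : 0 < Nat.card C := Nat.card_pos
  have hcard := Subgroup.card_eq_card_quotient_mul_card_subgroup C
  have h8 : 5 * Nat.card (H ⧸ C) ≤ 6 * (sqOne (H ⧸ C)).ncard + 6 := by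
    refine Nat.le_of_mul_le_mul_left ?_ hpos
    rw [← h6]
    nlinarith
  have hsix := card_eq_six_of_bounds hQ h8
  have hm : (sqOne (H ⧸ C)).ncard ≤ 4 := by
    have hex : ∃ q : H ⧸ C, q * q ≠ 1 := by
      by_contra hall
      push Not at hall
      exact hQ fun g => ⟨1, by rw [pow_one, pow_two, hall]⟩
    obtain ⟨q, hq⟩ := hex
    have := ncard_sqOne_add_two_le hq
    omega
  have h9 : Nat.card C * ∑ q ∈ Finset.univ.erase (1 : H ⧸ C), (if q * q = 1 then 1 else 0)
      ≤ Nat.card C * 3 := Nat.mul_le_mul_left _ (by omega)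
  rw [hsix] at hcard
  refine ⟨hVC, hsix, fun c hc => ?_, by omega⟩
  have h10 : sqOneFiber C 1 = (QuotientGroup.mk ⁻¹' {(1 : H ⧸ C)} : Set H) := by
    refine Set.eq_of_subset_of_ncard_le (fun t ht => ht.2) ?_
    rw [ncard_coset]
    omega
  have h11 : c ∈ sqOneFiber C 1 := by
    rw [h10]
    exact (QuotientGroup.eq_one_iff c).2 hc
  exact h11.1

/-- Counting elements of square `1` modulo a self-centralizing elementary abelian normal subgroup
of index `6`. -/
theorem half_centralizer_of_index_six {G : Type*} [Group G] [Finite G] (M : Subgroup G)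
    [hMn : M.Normal] (hM : ∀ x ∈ M, x * x = 1) (hidx : M.index = 6)
    (hcent : ∀ x, (∀ m ∈ M, x * m = m * x) → x ∈ M)
    (hT : 5 * Nat.card G ≤ 12 * (sqOne G).ncard) :
    (∀ t, t * t = 1 → t ∉ M →
      Nat.card M ≤ 2 * Nat.card (Subgroup.centralizer {t} ⊓ M : Subgroup G)) ∧
    ∃ s t, s * s = 1 ∧ t * t = 1 ∧ s ∉ M ∧ t ∉ M ∧ s * t ∉ M := by
  have hab : ∀ x ∈ M, ∀ y ∈ M, x * y = y * x := by
    intro x hx y hy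
    have h1 := inv_eq_of_mul_eq_one_right (hM _ (mul_mem hx hy))
    rw [mul_inv_rev, inv_eq_of_mul_eq_one_right (hM x hx),
      inv_eq_of_mul_eq_one_right (hM y hy)] at h1
    exact h1.symm
  have : Fintype (G ⧸ M) := Fintype.ofFinite _
  have hQ6 : Nat.card (G ⧸ M) = 6 := hidx
  have hpos : 0 < Nat.card M := Nat.card_pos
  have h2 : ∀ q : G ⧸ M, q ≠ 1 → 2 * (sqOneFiber M q).ncard ≤ Nat.card M := by
    intro q hq1
    obtain ⟨h, rfl⟩ := QuotientGroup.mk_surjective q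
    have : ∃ v ∈ M, h * v * h⁻¹ ≠ v⁻¹ := by
      by_contra hall
      push Not at hall
      refine hq1 ((QuotientGroup.eq_one_iff h).2 (hcent h fun v hv => ?_))
      rw [← mul_inv_eq_iff_eq_mul, hall v hv, inv_eq_of_mul_eq_one_right (hM v hv)]
    obtain ⟨v, hv, hvh⟩ := this
    exact mul_ncard_sqOneFiber_le M Nat.prime_two le_rfl (by rw [pow_two, hM v hv]) hv
      (fun c hc => by rw [hab c hc v hv, mul_inv_cancel_right]) hvh
  set I := Finset.univ.filter fun q : G ⧸ M => q ≠ 1 ∧ q * q = 1 with hI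
  have h5 := Finset.add_sum_erase Finset.univ (fun q : G ⧸ M => (sqOneFiber M q).ncard)
    (Finset.mem_univ 1)
  rw [sum_ncard_sqOneFiber] at h5
  have h6 : ∑ q ∈ I, (sqOneFiber M q).ncard =
      ∑ q ∈ Finset.univ.erase 1, (sqOneFiber M q).ncard := by
    refine Finset.sum_subset (fun q hq => ?_) fun q hq hqI => ?_
    · exact Finset.mem_erase.2 ⟨(Finset.mem_filter.1 hq).2.1, Finset.mem_univ _⟩
    · rw [sqOneFiber_eq_empty M, Set.ncard_empty]
      exact fun h => hqI (Finset.mem_filter.2 ⟨Finset.mem_univ _, Finset.ne_of_mem_erase hq, h⟩)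
  have hm : I.card ≤ 3 := by
    have : Fact (Nat.Prime 3) := ⟨Nat.prime_three⟩
    obtain ⟨q, hq⟩ := exists_prime_orderOf_dvd_card' (G := G ⧸ M) 3 (by rw [hQ6]; norm_num)
    have hq' : q * q ≠ 1 := fun h => by
      have := orderOf_dvd_of_pow_eq_one ((pow_two q).trans h)
      rw [hq] at this
      omega
    have h7 := ncard_sqOne_add_two_le hq'
    have h8 : I.card + 1 = (sqOne (G ⧸ M)).ncard := by
      rw [← Finset.card_insert_of_notMem (a := 1) (s := I) (by simp [hI]), ← Set.ncard_coe_finset]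
      congr 1
      ext x
      by_cases hx : x = 1 <;> simp [hI, hx, mem_sqOne]
    omega
  have h1 := ncard_sqOneFiber_le M 1
  have hcard := Subgroup.card_eq_card_quotient_mul_card_subgroup M
  rw [hQ6] at hcard
  have h8 : 3 * Nat.card M ≤ ∑ q ∈ I, 2 * (sqOneFiber M q).ncard := by
    rw [← Finset.mul_sum, h6]
    omega
  have h9 : ∀ q ∈ I, 2 * (sqOneFiber M q).ncard ≤ Nat.card M := fun q hq =>
    h2 q (Finset.mem_filter.1 hq).2.1
  have hfull : ∀ q ∈ I, Nat.card M ≤ 2 * (sqOneFiber M q).ncard := by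
    by_contra hlt
    push Not at hlt
    have := Finset.sum_lt_sum h9 hlt
    rw [Finset.sum_const, smul_eq_mul] at this
    nlinarith
  have hI3 : 3 ≤ I.card := by
    have := Finset.sum_le_sum h9
    rw [Finset.sum_const, smul_eq_mul] at this
    by_contra hlt
    have : I.card ≤ 2 := by omega
    nlinarith
  constructor
  · intro t ht htM
    refine (hfull t (Finset.mem_filter.2 ⟨Finset.mem_univ _, ?_, ?_⟩)).trans ?_
    · exact fun h => htM ((QuotientGroup.eq_one_iff t).1 h)
    · rw [← QuotientGroup.mk_mul, ht, QuotientGroup.mk_one]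
    · refine Nat.mul_le_mul_left 2 ?_
      rw [← Nat.card_coe_set_eq]
      have hinv : t⁻¹ = t := inv_eq_of_mul_eq_one_right ht
      refine Nat.card_le_card_of_injective (fun x => (⟨t * x, Subgroup.mem_inf.2 ?_⟩ :
        (Subgroup.centralizer {t} ⊓ M : Subgroup G))) fun x y hxy => ?_
      · have hx : t * x ∈ M := by
          have := QuotientGroup.eq.1 x.2.2.symm
          rwa [hinv] at this
        refine ⟨Subgroup.mem_centralizer_singleton_iff.2 ?_, hx⟩
        have hxinv : (x : G)⁻¹ = x := inv_eq_of_mul_eq_one_right x.2.1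
        have h10 := inv_eq_of_mul_eq_one_right (hM _ hx)
        rw [mul_inv_rev, hxinv, hinv] at h10
        rw [← h10, mul_assoc, ht, mul_one, h10, ← mul_assoc, ht, one_mul]
      · exact Subtype.ext (mul_left_cancel (congrArg Subtype.val hxy))
  · obtain ⟨a, ha, b, hb, hne⟩ := Finset.one_lt_card.1 (show 1 < I.card by omega)
    have hex : ∀ q ∈ I, ∃ t : G, t * t = 1 ∧ (t : G ⧸ M) = q := by
      intro q hq
      have h10 := hfull q hq
      have : (sqOneFiber M q).Nonempty := by
        rw [← Set.ncard_pos]; omega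
      exact this
    obtain ⟨s, hs, rfl⟩ := hex a ha
    obtain ⟨t, ht, rfl⟩ := hex b hb
    have hne1 : ∀ {x : G}, (x : G ⧸ M) ∈ I → x ∉ M := fun hx hxM =>
      (Finset.mem_filter.1 hx).2.1 ((QuotientGroup.eq_one_iff _).2 hxM)
    refine ⟨s, t, hs, ht, hne1 ha, hne1 hb, fun h => hne ?_⟩
    rw [QuotientGroup.eq, inv_eq_of_mul_eq_one_right hs]
    exact h

/-- In a group with a normal elementary abelian subgroup of index `6`, two involutions from
distinct cosets can be replaced by generators of a dihedral complement. -/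
theorem exists_dihedral_of_index_six {G : Type*} [Group G] [Finite G] (M : Subgroup G)
    [hMn : M.Normal] (hM : ∀ x ∈ M, x * x = 1) (hidx : M.index = 6) {s t : G}
    (hs : s * s = 1) (ht : t * t = 1) (hsM : s ∉ M) (htM : t ∉ M) (hst : s * t ∉ M) :
    ∃ u, u ^ 3 = 1 ∧ s * u * s⁻¹ = u⁻¹ ∧ u ∉ M ∧ s * u ∉ M := by
  have hQ6 : Nat.card (G ⧸ M) = 6 := hidx
  have : Fact (Nat.Prime 3) := ⟨Nat.prime_three⟩
  obtain ⟨c, hc⟩ := exists_prime_orderOf_dvd_card' (G := G ⧸ M) 3 (by rw [hQ6]; norm_num)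
  have hcard : Nat.card (Subgroup.zpowers c) = 3 := by rw [Nat.card_zpowers, hc]
  have hi : (Subgroup.zpowers c).index = 2 := by
    have := (Subgroup.zpowers c).index_mul_card
    rw [hcard, hQ6] at this
    omega
  have hcube : ∀ x ∈ Subgroup.zpowers c, x ^ 3 = 1 := by
    rintro _ ⟨k, rfl⟩
    change (c ^ k) ^ 3 = 1
    rw [← zpow_natCast, ← zpow_mul, mul_comm, zpow_mul, zpow_natCast, ← hc, pow_orderOf_eq_one,
      one_zpow]
  have hnot : ∀ x : G, x * x = 1 → x ∉ M → (x : G ⧸ M) ∉ Subgroup.zpowers c := by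
    intro x hx hxM h
    have h1 := hcube _ h
    rw [pow_succ, pow_two, ← QuotientGroup.mk_mul, hx, QuotientGroup.mk_one, one_mul] at h1
    exact hxM ((QuotientGroup.eq_one_iff x).1 h1)
  have hmem : ((s * t : G) : G ⧸ M) ∈ Subgroup.zpowers c := by
    rw [QuotientGroup.mk_mul, Subgroup.mul_mem_iff_of_index_two hi]
    exact iff_of_false (hnot s hs hsM) (hnot t ht htM)
  have h3 : (s * t) ^ 3 ∈ M := (QuotientGroup.eq_one_iff _).1 (hcube _ hmem)
  have h6 : (s * t) ^ 6 = 1 := by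
    rw [show 6 = 3 + 3 from rfl, pow_add, hM _ h3]
  have hsinv : s⁻¹ = s := inv_eq_of_mul_eq_one_right hs
  have htinv : t⁻¹ = t := inv_eq_of_mul_eq_one_right ht
  have hu : (s * t) ^ 4 = (s * t) ^ 3 * (s * t) := by rw [← pow_succ]
  refine ⟨(s * t) ^ 4, ?_, ?_, ?_, ?_⟩
  · rw [← pow_mul, show 4 * 3 = 6 * 2 from rfl, pow_mul, h6, one_pow]
  · rw [← conj_pow, ← inv_pow, mul_inv_rev, htinv, hsinv, ← mul_assoc, hs, one_mul]
  · rw [hu]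
    exact fun h => hst ((M.mul_mem_cancel_left h3).1 h)
  · intro h
    have h4 : s * (s * t) ^ 4 = (s * (s * t) ^ 3 * s⁻¹) * t := by
      rw [hu, hsinv]
      simp only [mul_assoc]
    rw [h4] at h
    exact htM ((M.mul_mem_cancel_left (hMn.conj_mem _ h3 s)).1 h)

theorem prime_dvd_relIndex {G : Type*} [Group G] {M L : Subgroup G} [M.Normal] {p : ℕ}
    (hp : p.Prime) {g : G} (hgL : g ∈ L) (hgM : g ∉ M) (hg : g ^ p ∈ M) : p ∣ M.relIndex L := by
  have : Fact p.Prime := ⟨hp⟩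
  let x : L ⧸ M.subgroupOf L := ((⟨g, hgL⟩ : L) : L ⧸ M.subgroupOf L)
  have hx : orderOf x = p := by
    refine orderOf_eq_prime ?_ ?_
    · exact (QuotientGroup.eq_one_iff _).2 (Subgroup.mem_subgroupOf.2 hg)
    · exact fun h => hgM (Subgroup.mem_subgroupOf.1 ((QuotientGroup.eq_one_iff _).1 h))
  rw [← hx]
  exact orderOf_dvd_natCard x

theorem eq_top_of_index_six {G : Type*} [Group G] {M L : Subgroup G} [M.Normal]
    (hidx : M.index = 6) (hML : M ≤ L) {s u : G} (hs : s * s = 1) (hu : u ^ 3 = 1)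
    (hsM : s ∉ M) (huM : u ∉ M) (hsL : s ∈ L) (huL : u ∈ L) : L = ⊤ := by
  have h2 := prime_dvd_relIndex Nat.prime_two hsL hsM (by rw [pow_two, hs]; exact one_mem M)
  have h3 := prime_dvd_relIndex Nat.prime_three huL huM (by rw [hu]; exact one_mem M)
  have h := Subgroup.relIndex_mul_index hML
  rw [hidx] at h
  have h6 : 6 ∣ M.relIndex L := (Nat.Coprime.mul_dvd_of_dvd_of_dvd (by norm_num) h2 h3)
  rw [← Subgroup.index_eq_one]
  obtain ⟨k, hk⟩ := h6
  rw [hk, mul_assoc] at h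
  have : k * L.index = 1 := by omega
  exact Nat.eq_one_of_mul_eq_one_left this

theorem exists_norm_kernel {A : Type*} [CommGroup A] (hA : ∀ x : A, x * x = 1) (f : A →* A)
    (hf : ∀ x, f (f (f x)) = x) :
    ∃ W : Subgroup A, (∀ x, x ∈ W ↔ x * f x * f (f x) = 1) ∧ (∀ x ∈ W, f x = x → x = 1) ∧
      ∀ x, ∃ z, ∃ w ∈ W, f z = z ∧ z * w = x := by
  let N : A →* A := MonoidHom.id A * f * f.comp f
  have hN : ∀ x, N x = x * f x * f (f x) := fun x => rfl
  refine ⟨N.ker, fun x => Iff.rfl, fun x hx hfx => ?_, fun x => ?_⟩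
  · have : x * f x * f (f x) = 1 := hx
    rwa [hfx, hfx, hA, one_mul] at this
  · have hfN : f (N x) = N x := by
      rw [hN, map_mul, map_mul, hf, mul_comm, mul_assoc]
    refine ⟨N x, N x * x, ?_, hfN, by rw [← mul_assoc, hA, one_mul]⟩
    rw [MonoidHom.mem_ker, map_mul, hN (N x), hfN, hfN, hA, one_mul, hA]

/-- The part of an elementary abelian normal subgroup on which an element of order `3` has no
fixed points. -/
theorem exists_fixed_point_free_part {G : Type*} [Group G] {M : Subgroup G} [hMn : M.Normal]
    (hM : ∀ x ∈ M, x * x = 1) (hab : ∀ x ∈ M, ∀ y ∈ M, x * y = y * x) {u : G} (hu : u ^ 3 = 1) :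
    ∃ W : Subgroup G, W ≤ M ∧
      (∀ x ∈ M, x ∈ W ↔ x * (u * x * u⁻¹) * (u⁻¹ * x * u) = 1) ∧
      (∀ x ∈ W, u * x * u⁻¹ = x → x = 1) ∧
      ∀ x ∈ M, ∃ z ∈ M, ∃ w ∈ W, u * z * u⁻¹ = z ∧ z * w = x := by
  let _ : CommGroup M := { (inferInstance : Group M) with
    mul_comm := fun x y => Subtype.ext (hab x x.2 y y.2) }
  let f : M →* M := (MulAut.conjNormal u : MulAut M).toMonoidHom
  have hf : ∀ x : M, (f x : G) = u * x * u⁻¹ := fun x => MulAut.conjNormal_apply u x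
  have hu2 : u * u = u⁻¹ := by
    rw [eq_inv_iff_mul_eq_one, ← hu, pow_succ, pow_two]
  have hff : ∀ x : M, (f (f x) : G) = u⁻¹ * x * u := fun x => by
    rw [hf, hf]
    calc u * (u * x * u⁻¹) * u⁻¹ = u * u * x * (u * u)⁻¹ := by group
      _ = u⁻¹ * x * u := by rw [hu2, inv_inv]
  obtain ⟨W, hW1, hW2, hW3⟩ := exists_norm_kernel (fun x => Subtype.ext (hM x x.2)) f
    (fun x => Subtype.ext (by rw [hf, hff]; group))
  have hmem : ∀ x : G, ∀ hx : x ∈ M, x ∈ W.map M.subtype ↔ (⟨x, hx⟩ : M) ∈ W := by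
    intro x hx
    constructor
    · rintro ⟨y, hy, rfl⟩
      exact hy
    · exact fun h => ⟨_, h, rfl⟩
  refine ⟨W.map M.subtype, ?_, fun x hx => ?_, ?_, fun x hx => ?_⟩
  · rintro _ ⟨y, -, rfl⟩
    exact y.2
  · rw [hmem x hx, hW1, Subtype.ext_iff]
    change x * (f ⟨x, hx⟩ : G) * (f (f ⟨x, hx⟩) : G) = 1 ↔ _
    rw [hf, hff]
  · rintro _ ⟨x, hx, rfl⟩ h
    rw [hW2 x hx (Subtype.ext ((hf x).trans h))]
    rfl
  · obtain ⟨z, w, hw, hz, hzw⟩ := hW3 ⟨x, hx⟩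
    refine ⟨z, z.2, w, ⟨w, hw, rfl⟩, ?_, congrArg Subtype.val hzw⟩
    rw [← hf, hz]

theorem dihedral_complement {G : Type*} [Group G] {M : Subgroup G} {s u : G}
    [hMn : M.Normal] (hs : s * s = 1) (hu : u ^ 3 = 1) (hsu : s * u * s⁻¹ = u⁻¹) (huM : u ∉ M) :
    ∃ D : Subgroup G, s ∈ D ∧ u ∈ D ∧ D ⊓ M = ⊥ := by
  have hc : ∀ k : ℤ, s * u ^ k = u ^ (-k) * s := fun k => by
    rw [← mul_inv_eq_iff_eq_mul, ← conj_zpow, hsu, inv_zpow, zpow_neg]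
  let D : Subgroup G :=
    { carrier := {x | (∃ k : ℤ, x = u ^ k) ∨ ∃ k : ℤ, x = u ^ k * s}
      one_mem' := Or.inl ⟨0, (zpow_zero u).symm⟩
      mul_mem' := by
        rintro a b (⟨k, rfl⟩ | ⟨k, rfl⟩) (⟨l, rfl⟩ | ⟨l, rfl⟩)
        · exact Or.inl ⟨k + l, (zpow_add u k l).symm⟩
        · exact Or.inr ⟨k + l, by rw [zpow_add, mul_assoc]⟩
        · exact Or.inr ⟨k + -l, by rw [zpow_add, mul_assoc, hc, mul_assoc]⟩
        · refine Or.inl ⟨k + -l, ?_⟩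
          rw [zpow_add, mul_assoc, ← mul_assoc s, hc, mul_assoc (u ^ (-l)), hs, mul_one]
      inv_mem' := by
        rintro a (⟨k, rfl⟩ | ⟨k, rfl⟩)
        · exact Or.inl ⟨-k, (zpow_neg u k).symm⟩
        · refine Or.inr ⟨k, ?_⟩
          rw [mul_inv_rev, inv_eq_of_mul_eq_one_right hs, ← zpow_neg, hc, neg_neg] }
  refine ⟨D, Or.inr ⟨0, by rw [zpow_zero, one_mul]⟩, Or.inl ⟨1, (zpow_one u).symm⟩, ?_⟩
  rw [eq_bot_iff]
  rintro x ⟨⟨k, rfl⟩ | ⟨k, rfl⟩, hx⟩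
  · rw [Subgroup.mem_bot]
    by_contra h
    have hou : orderOf u = 3 := orderOf_eq_prime hu fun h1 => huM (h1 ▸ one_mem M)
    have h1 : u ∈ M := by
      refine zpowers_le_of_prime (by rw [hou]; exact Nat.prime_three) (fun hbot => h ?_)
      have : u ^ k ∈ Subgroup.zpowers u ⊓ M := ⟨⟨k, rfl⟩, hx⟩
      rwa [hbot] at this
    exact huM h1
  · have h1 : u * (u ^ k * s) * u⁻¹ ∈ M := hMn.conj_mem _ hx u
    have h2 : u * (u ^ k * s) * u⁻¹ = u * u * (u ^ k * s) := by
      have h3 : s * u⁻¹ = u * s := by simpa using hc (-1)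
      rw [mul_assoc, mul_assoc (u ^ k), h3]
      group
    rw [h2, M.mul_mem_cancel_right hx] at h1
    have h3 : (u * u) * (u * u) = u := by
      calc (u * u) * (u * u) = u ^ 3 * u := by simp [pow_succ, mul_assoc]
        _ = u := by rw [hu, one_mul]
    exact absurd (h3 ▸ mul_mem h1 h1) huM

theorem four_le_card_of_fixed_point_free {G : Type*} [Group G] [Finite G] {W : Subgroup G} {u : G}
    (hW : ∀ x ∈ W, x * x = 1) (hu : ∀ x ∈ W, u * x * u⁻¹ ∈ W)
    (hfix : ∀ x ∈ W, u * x * u⁻¹ = x → x = 1) (hne : W ≠ ⊥) : 4 ≤ Nat.card W := by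
  obtain ⟨w, hw, hw1⟩ := W.bot_or_exists_ne_one.resolve_left hne
  set w' := u * w * u⁻¹ with hw'
  have hw'W : w' ∈ W := hu w hw
  have h1 : w' ≠ w := fun h => hw1 (hfix w hw h)
  have h2 : w' ≠ 1 := fun h => hw1 (conj_eq_one_iff.1 h)
  have h3 : w * w' ≠ 1 := fun h => h1 (mul_left_cancel (h.trans (hW w hw).symm))
  have hsub : ({1, w, w', w * w'} : Set G) ⊆ W := by
    rintro x (rfl | rfl | rfl | rfl)
    exacts [one_mem W, hw, hw'W, mul_mem hw hw'W]
  have hcard : ({1, w, w', w * w'} : Set G).ncard = 4 := by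
    rw [Set.ncard_insert_of_notMem, Set.ncard_insert_of_notMem, Set.ncard_pair]
    · intro h; exact hw1 (mul_eq_right.1 h.symm)
    · simp only [Set.mem_insert_iff, Set.mem_singleton_iff, not_or]
      exact ⟨h1.symm, fun h => h2 (mul_eq_left.1 h.symm)⟩
    · simp only [Set.mem_insert_iff, Set.mem_singleton_iff, not_or]
      exact ⟨hw1.symm, h2.symm, h3.symm⟩
  rw [← hcard, ← Nat.card_coe_set_eq]
  exact Nat.card_mono (Set.toFinite _) hsub

theorem card_mul_card_le_of_inf_eq_bot {G : Type*} [Group G] [Finite G] {Z W M : Subgroup G}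
    (hZ : Z ≤ M) (hW : W ≤ M) (h : Z ⊓ W = ⊥) : Nat.card Z * Nat.card W ≤ Nat.card M := by
  rw [← Nat.card_prod]
  refine Nat.card_le_card_of_injective
    (fun x => (⟨x.1 * x.2, mul_mem (hZ x.1.2) (hW x.2.2)⟩ : M)) fun x y hxy => ?_
  have := Subgroup.mul_injective_of_disjoint (disjoint_iff.2 h)
  exact this (congrArg Subtype.val hxy)

/-- If two subgroups each meet `M` in at least half of `M`, they meet it jointly in at least a
quarter. -/
theorem card_le_four_mul_card_inf_inf {G : Type*} [Group G] [Finite G] {M A B : Subgroup G}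
    (hA : Nat.card M ≤ 2 * Nat.card (A ⊓ M : Subgroup G))
    (hB : Nat.card M ≤ 2 * Nat.card (B ⊓ M : Subgroup G)) :
    Nat.card M ≤ 4 * Nat.card (A ⊓ B ⊓ M : Subgroup G) := by
  have key : ∀ L : Subgroup G, L.relIndex M * Nat.card (L ⊓ M : Subgroup G) = Nat.card M := by
    intro L
    have := Subgroup.relIndex_mul_relIndex ⊥ (L ⊓ M) M bot_le inf_le_right
    rw [Subgroup.relIndex_bot_left, Subgroup.relIndex_bot_left, Subgroup.inf_relIndex_right] at this
    rw [mul_comm, this]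
  have hbound : ∀ L : Subgroup G, Nat.card M ≤ 2 * Nat.card (L ⊓ M : Subgroup G) →
      L.relIndex M ≤ 2 := by
    intro L hL
    have h1 := key L
    have h2 : 0 < Nat.card (L ⊓ M : Subgroup G) := Nat.card_pos
    by_contra h3
    have : 3 ≤ L.relIndex M := by omega
    nlinarith
  have h1 := Subgroup.relIndex_inf_le (H := A) (K := B) (L := M)
  have h2 := Nat.mul_le_mul (hbound A hA) (hbound B hB)
  have h3 := key (A ⊓ B)
  rw [← h3]
  exact Nat.mul_le_mul_right _ (h1.trans h2)

theorem exists_mulEquiv_prod_perm_four {G : Type*} [Group G] [Finite G] (M : Subgroup G)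
    [hMn : M.Normal] (hM : ∀ x ∈ M, x * x = 1) (hidx : M.index = 6)
    (hcent : ∀ x, (∀ m ∈ M, x * m = m * x) → x ∈ M)
    (hhalf : ∀ t, t * t = 1 → t ∉ M →
      Nat.card M ≤ 2 * Nat.card (Subgroup.centralizer {t} ⊓ M : Subgroup G))
    {s u : G} (hs : s * s = 1) (hu : u ^ 3 = 1) (hsu : s * u * s⁻¹ = u⁻¹)
    (hsM : s ∉ M) (huM : u ∉ M) (hsuM : s * u ∉ M) :
    ∃ (K : Subgroup G) (_ : K.Normal), (∀ a : G ⧸ K, a * a = 1) ∧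
      Nonempty (G ≃* (G ⧸ K) × Equiv.Perm (Fin 4)) := by
  have hab : ∀ x ∈ M, ∀ y ∈ M, x * y = y * x := by
    intro x hx y hy
    have h1 := inv_eq_of_mul_eq_one_right (hM _ (mul_mem hx hy))
    rw [mul_inv_rev, inv_eq_of_mul_eq_one_right (hM x hx),
      inv_eq_of_mul_eq_one_right (hM y hy)] at h1
    exact h1.symm
  have hsinv : s⁻¹ = s := inv_eq_of_mul_eq_one_right hs
  have hou : orderOf u = 3 := orderOf_eq_prime hu fun h1 => huM (h1 ▸ one_mem M)
  have htop : ∀ L : Subgroup G, M ≤ L → s ∈ L → u ∈ L → L = ⊤ := fun L hML hsL huL =>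
    eq_top_of_index_six hidx hML hs hu hsM huM hsL huL
  obtain ⟨W, hWM, hWmem, hWfix, hWdecomp⟩ := exists_fixed_point_free_part hM hab hu
  have hWu : ∀ x ∈ W, u * x * u⁻¹ ∈ W := by
    intro x hx
    rw [hWmem _ (hMn.conj_mem x (hWM hx) u)]
    have h1 := (hWmem x (hWM hx)).1 hx
    have h2 : u * (u * x * u⁻¹) * u⁻¹ = u⁻¹ * x * u := by
      have hu2 : u * u = u⁻¹ := by
        rw [eq_inv_iff_mul_eq_one, ← hu, pow_succ, pow_two]
      calc u * (u * x * u⁻¹) * u⁻¹ = u * u * x * (u * u)⁻¹ := by group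
        _ = u⁻¹ * x * u := by rw [hu2, inv_inv]
    have h3 : u⁻¹ * (u * x * u⁻¹) * u = x := by group
    rw [h2, h3]
    rw [mul_assoc] at h1
    exact mul_eq_one_comm.1 h1
  have hWs : ∀ x ∈ W, s * x * s⁻¹ ∈ W := by
    intro x hx
    have hxM := hWM hx
    rw [hWmem _ (hMn.conj_mem x hxM s)]
    have h1 := (hWmem x hxM).1 hx
    have hus : u * s = s * u⁻¹ := by
      rw [← hsu, ← mul_assoc, ← mul_assoc, hs, one_mul, hsinv]
    have hus' : u⁻¹ * s = s * u := by
      rw [inv_mul_eq_iff_eq_mul, ← mul_assoc, hus, mul_assoc, inv_mul_cancel, mul_one]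
    have h2 : u * (s * x * s⁻¹) * u⁻¹ = s * (u⁻¹ * x * u) * s⁻¹ := by
      calc u * (s * x * s⁻¹) * u⁻¹ = (u * s) * x * (u * s)⁻¹ := by group
        _ = s * (u⁻¹ * x * u) * s⁻¹ := by rw [hus]; group
    have h3 : u⁻¹ * (s * x * s⁻¹) * u = s * (u * x * u⁻¹) * s⁻¹ := by
      calc u⁻¹ * (s * x * s⁻¹) * u = (u⁻¹ * s) * x * (u⁻¹ * s)⁻¹ := by group
        _ = s * (u * x * u⁻¹) * s⁻¹ := by rw [hus']; group
    have h4 : u * x * u⁻¹ ∈ M := hMn.conj_mem x hxM u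
    have h5 : u⁻¹ * x * u ∈ M := by simpa using hMn.conj_mem x hxM u⁻¹
    rw [h2, h3, conj_mul, conj_mul, mul_assoc x, hab _ h5 _ h4, ← mul_assoc x, h1, mul_one,
      mul_inv_cancel]
  have hWn : W.Normal := by
    rw [← Subgroup.normalizer_eq_top_iff]
    refine htop _ (fun m hm => ?_) ?_ ?_
    · refine Subgroup.mem_normalizer_fintype fun x hx => ?_
      rw [hab m hm x (hWM hx), mul_inv_cancel_right]
      exact hx
    · exact Subgroup.mem_normalizer_fintype hWs
    · exact Subgroup.mem_normalizer_fintype hWu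
  have hWbot : W ≠ ⊥ := by
    intro hbot
    refine huM (hcent u fun m hm => ?_)
    obtain ⟨z, hz, w, hw, hzu, rfl⟩ := hWdecomp m hm
    rw [hbot, Subgroup.mem_bot] at hw
    rw [hw, mul_one, ← mul_inv_eq_iff_eq_mul, hzu]
  have hW4 := four_le_card_of_fixed_point_free (fun x hx => hM x (hWM hx)) hWu hWfix hWbot
  set Z := Subgroup.centralizer {u} ⊓ M with hZ
  have hZmem : ∀ {z}, z ∈ Z ↔ u * z * u⁻¹ = z ∧ z ∈ M := fun {z} => by
    rw [hZ, Subgroup.mem_inf, Subgroup.mem_centralizer_singleton_iff, mul_inv_eq_iff_eq_mul,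
      eq_comm]
  have hZW : Z ⊓ W = ⊥ := by
    rw [eq_bot_iff]
    rintro x ⟨hx, hxW⟩
    exact hWfix x hxW (hZmem.1 hx).1
  have hcardZ := card_mul_card_le_of_inf_eq_bot (inf_le_right : Z ≤ M) hWM hZW
  have hsu2 : s * u * (s * u) = 1 := by
    rw [hsinv] at hsu
    rw [← mul_assoc, hsu, inv_mul_cancel]
  have hM4 := card_le_four_mul_card_inf_inf (hhalf s hs hsM) (hhalf (s * u) hsu2 hsuM)
  have hle : Subgroup.centralizer {s} ⊓ Subgroup.centralizer {s * u} ⊓ M ≤ Z := by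
    rintro x ⟨⟨h1, h2⟩, hx⟩
    refine ⟨?_, hx⟩
    have h1 := Subgroup.mem_centralizer_singleton_iff.1 h1
    have h2 := Subgroup.mem_centralizer_singleton_iff.1 h2
    refine Subgroup.mem_centralizer_singleton_iff.2 ?_
    rw [← mul_assoc, h1, mul_assoc, mul_assoc] at h2
    exact mul_left_cancel h2
  have hZ0 := Subgroup.eq_of_le_of_card_ge hle (by nlinarith)
  have hMZ : Nat.card M = 4 * Nat.card Z := by rw [hZ0] at hM4; nlinarith
  have hcentral : ∀ z ∈ Z, ∀ g, z * g = g * z := by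
    intro z hz
    have h1 : Subgroup.centralizer {z} = ⊤ := by
      refine htop _ (fun m hm => ?_) ?_ ?_
      · exact Subgroup.mem_centralizer_singleton_iff.2 (hab m hm z (hZmem.1 hz).2)
      · have : z ∈ Subgroup.centralizer {s} := by
          rw [← hZ0] at hz; exact hz.1.1
        exact Subgroup.mem_centralizer_singleton_iff.2
          (Subgroup.mem_centralizer_singleton_iff.1 this).symm
      · exact Subgroup.mem_centralizer_singleton_iff.2
          (Subgroup.mem_centralizer_singleton_iff.1 (Subgroup.mem_inf.1 hz).1).symm
    intro g
    have : g ∈ Subgroup.centralizer {z} := h1 ▸ Subgroup.mem_top g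
    exact (Subgroup.mem_centralizer_singleton_iff.1 this).symm
  -- the action on the four conjugates of the subgroup generated by `u`
  have mem_Y := @mem_normalizer_zpowers G _ _ u
  generalize Subgroup.normalizer (Subgroup.zpowers u : Set G) = Y at mem_Y
  have hYM : Y ⊓ M = Z := by
    ext m
    rw [Subgroup.mem_inf, hZmem, mem_Y]
    constructor
    · rintro ⟨h, hm⟩
      refine ⟨?_, hm⟩
      have h1 : m * u * m⁻¹ * u⁻¹ ∈ Subgroup.zpowers u ⊓ M := by
        refine Subgroup.mem_inf.2 ⟨mul_mem h (inv_mem (Subgroup.mem_zpowers u)), ?_⟩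
        have := mul_mem hm (hMn.conj_mem _ (inv_mem hm) u)
        simpa only [mul_assoc] using this
      by_cases hbot : Subgroup.zpowers u ⊓ M = ⊥
      · rw [hbot, Subgroup.mem_bot, mul_inv_eq_one, mul_inv_eq_iff_eq_mul] at h1
        rw [← h1, mul_inv_cancel_right]
      · exact absurd (zpowers_le_of_prime (by rw [hou]; exact Nat.prime_three) hbot) huM
    · rintro ⟨h, hm⟩
      refine ⟨?_, hm⟩
      have : m * u * m⁻¹ = u := by
        rw [mul_inv_eq_iff_eq_mul] at h ⊢
        exact h.symm
      rw [this]
      exact Subgroup.mem_zpowers u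
  have hY4 : Y.index = 4 := by
    have h1 : Y ⊔ M = ⊤ := htop _ le_sup_right
      (Subgroup.mem_sup_left (mem_Y.2 (by rw [hsu]; exact inv_mem (Subgroup.mem_zpowers u))))
      (Subgroup.mem_sup_left (mem_Y.2 (by
        rw [mul_inv_cancel_right]; exact Subgroup.mem_zpowers u)))
    have h2 : M.relIndex Y = 6 := by
      rw [← Subgroup.relIndex_sup_right, h1, Subgroup.relIndex_top_right, hidx]
    have h3 := Subgroup.relIndex_mul_relIndex ⊥ (M ⊓ Y) Y bot_le inf_le_right
    rw [Subgroup.relIndex_bot_left, Subgroup.relIndex_bot_left, Subgroup.inf_relIndex_right, h2,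
      inf_comm, hYM] at h3
    have h4 := Y.index_mul_card
    have h5 := M.index_mul_card
    rw [hidx, hMZ, ← h4, ← h3] at h5
    have h6 : 0 < Nat.card Z := Nat.card_pos
    nlinarith
  let φ := MulAction.toPermHom G (G ⧸ Y)
  have hker : ∀ x, φ x = 1 → x ∈ Z := by
    intro x hx
    have hxY : ∀ y ∈ φ.ker, y ∈ Y := by
      intro y hy
      rw [← Subgroup.normalCore_eq_ker] at hy
      exact Y.normalCore_le hy
    have hxM : x ∈ M := by
      refine hcent x fun m hm => ?_
      obtain ⟨z, hz, w, hw, hzu, rfl⟩ := hWdecomp m hm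
      have h1 : w * x * w⁻¹ * x⁻¹ ∈ Z ⊓ W := by
        have hW' : w * x * w⁻¹ * x⁻¹ ∈ W := by
          have := mul_mem hw (hWn.conj_mem _ (inv_mem hw) x)
          simpa only [mul_assoc] using this
        refine ⟨?_, hW'⟩
        rw [SetLike.mem_coe, ← hYM]
        refine ⟨hxY _ (mul_mem (MonoidHom.normal_ker φ |>.conj_mem x hx w) (inv_mem hx)), hWM hW'⟩
      rw [hZW, Subgroup.mem_bot, mul_inv_eq_one, mul_inv_eq_iff_eq_mul] at h1
      rw [← mul_assoc, ← hcentral z (hZmem.2 ⟨hzu, hz⟩) x, mul_assoc, mul_assoc, h1]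
    rw [← hYM]
    exact ⟨hxY x hx, hxM⟩
  obtain ⟨D, hsD, huD, hDM⟩ := dihedral_complement hs hu hsu huM
  have hsup : Z ⊔ (W ⊔ D) = ⊤ := by
    refine htop _ (fun m hm => ?_) (Subgroup.mem_sup_right (Subgroup.mem_sup_right hsD))
      (Subgroup.mem_sup_right (Subgroup.mem_sup_right huD))
    obtain ⟨z, hz, w, hw, hzu, rfl⟩ := hWdecomp m hm
    exact mul_mem (Subgroup.mem_sup_left (hZmem.2 ⟨hzu, hz⟩))
      (Subgroup.mem_sup_right (Subgroup.mem_sup_left hw))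
  have hinf : ∀ x ∈ W ⊔ D, x ∈ Z → x = 1 := by
    intro x hx hxZ
    obtain ⟨w, hw, d, hd, rfl⟩ := Subgroup.mem_sup_of_normal_left.1 hx
    have hdM : d ∈ M := (M.mul_mem_cancel_left (hWM hw)).1 (hZmem.1 hxZ).2
    have hd1 : d ∈ D ⊓ M := ⟨hd, hdM⟩
    rw [hDM, Subgroup.mem_bot] at hd1
    rw [hd1, mul_one] at hxZ ⊢
    have : w ∈ Z ⊓ W := ⟨hxZ, hw⟩
    rwa [hZW] at this
  generalize W ⊔ D = K at hsup hinf
  have hKn : K.Normal := by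
    rw [← Subgroup.normalizer_eq_top_iff, eq_top_iff, ← hsup]
    refine sup_le (fun z hz => ?_) Subgroup.le_normalizer
    refine Subgroup.mem_normalizer_fintype fun x hx => ?_
    rw [hcentral z hz, mul_inv_cancel_right]
    exact hx
  have e : G ⧸ Y ≃ Fin 4 := Finite.equivFinOfCardEq hY4
  let F : G →* (G ⧸ K) × Equiv.Perm (Fin 4) :=
    (QuotientGroup.mk' K).prod (e.permCongrHom.toMonoidHom.comp φ)
  have hF : Function.Injective F := by
    rw [injective_iff_map_eq_one]
    intro x hx
    refine hinf x ((QuotientGroup.eq_one_iff x).1 (congrArg Prod.fst hx)) (hker x ?_)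
    have : e.permCongrHom (φ x) = 1 := congrArg Prod.snd hx
    exact e.permCongrHom.injective (this.trans (map_one e.permCongrHom).symm)
  refine ⟨K, hKn, fun a => ?_, ⟨MulEquiv.ofBijective F ?_⟩⟩
  · obtain ⟨x, rfl⟩ := QuotientGroup.mk_surjective a
    obtain ⟨z, hz, k, hk, rfl⟩ := Subgroup.mem_sup_of_normal_right.1
      (hsup ▸ Subgroup.mem_top x : x ∈ Z ⊔ K)
    rw [QuotientGroup.mk_mul, (QuotientGroup.eq_one_iff k).2 hk, mul_one, ← QuotientGroup.mk_mul,
      hM z (hZmem.1 hz).2, QuotientGroup.mk_one]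
  · refine hF.bijective_of_nat_card_le ?_
    have h1 : Nat.card (G ⧸ K) ≤ Nat.card Z := by
      have h2 : K.relIndex Z = K.index := by
        rw [← Subgroup.relIndex_sup_right, hsup, Subgroup.relIndex_top_right]
      change K.index ≤ _
      rw [← h2]
      exact Nat.le_of_dvd Nat.card_pos (Subgroup.index_dvd_card _)
    have h5 := M.index_mul_card
    rw [hidx, hMZ] at h5
    rw [Nat.card_prod, Nat.card_perm, Nat.card_fin, ← h5]
    norm_num [Nat.factorial]
    omega

theorem exists_mulEquiv_prod_perm_four_of_not_isSupersolvable {G : Type*} [Group G] [Finite G]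
    (h : ¬ IsSupersolvable G) (hG : 5 * Nat.card G ≤ 12 * (sqOne G).ncard) :
    ∃ (K : Subgroup G) (_ : K.Normal), (∀ a : G ⧸ K, a * a = 1) ∧
      Nonempty (G ≃* (G ⧸ K) × Equiv.Perm (Fin 4)) := by
  obtain ⟨K, hK, V, hV, hne⟩ := exists_isMinNormal_ne_zpowers h
  obtain ⟨hVC, hidx, hC, hT⟩ :=
    IsMinNormal.centralizer_of_ne_zpowers hV hne (five_card_le_quotient K hG)
  have hsq : sqOne G = QuotientGroup.mk ⁻¹' sqOne (G ⧸ K) := by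
    refine Set.eq_of_subset_of_ncard_le (sqOne_subset_preimage K) ?_ (Set.toFinite _)
    have h1 := Subgroup.card_eq_card_quotient_mul_card_subgroup K
    rw [ncard_preimage_mk]
    nlinarith
  have hVn : V.Normal := hV.1
  let M := (Subgroup.centralizer (V : Set (G ⧸ K))).comap (QuotientGroup.mk' K)
  have hM : ∀ x ∈ M, x * x = 1 := by
    intro x hx
    have : x ∈ sqOne G := by
      rw [hsq]
      exact hC _ hx
    exact this
  have hMidx : M.index = 6 := by
    rw [← hidx]
    exact Subgroup.index_comap_of_surjective _ (QuotientGroup.mk'_surjective K)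
  have hcent : ∀ x, (∀ m ∈ M, x * m = m * x) → x ∈ M := by
    intro x hx
    refine Subgroup.mem_comap.2 (Subgroup.mem_centralizer_iff.2 fun v hv => ?_)
    obtain ⟨m, rfl⟩ := QuotientGroup.mk'_surjective K v
    rw [← map_mul, ← map_mul, hx m (hVC hv)]
  obtain ⟨hhalf, s, t, hs, ht, hsM, htM, hst⟩ :=
    half_centralizer_of_index_six M hM hMidx hcent hG
  obtain ⟨u, hu, hsu, huM, hsuM⟩ := exists_dihedral_of_index_six M hM hMidx hs ht hsM htM hst
  exact exists_mulEquiv_prod_perm_four M hM hMidx hcent hhalf hs hu hsu hsM huM hsuM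

theorem exists_mulEquiv_zmod_two {A : Type*} [Group A] [Finite A] (hA : ∀ a : A, a * a = 1) :
    ∃ n : ℕ, Nonempty (A ≃* (Fin n → Multiplicative (ZMod 2))) := by
  let _ : CommGroup A := { ‹Group A› with
    mul_comm := fun a b => by
      have h1 := inv_eq_of_mul_eq_one_right (hA (a * b))
      rw [mul_inv_rev, inv_eq_of_mul_eq_one_right (hA a),
        inv_eq_of_mul_eq_one_right (hA b)] at h1
      exact h1.symm }
  let _ : Module (ZMod 2) (Additive A) := AddCommGroup.zmodModule fun a => by
    rw [two_nsmul]
    exact hA a.toMul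
  have : Module.Finite (ZMod 2) (Additive A) := Module.Finite.of_finite
  let e := (Module.finBasis (ZMod 2) (Additive A)).equivFun
  exact ⟨_, ⟨{ toFun := fun a i => Multiplicative.ofAdd (e (Additive.ofMul a) i)
               invFun := fun f => (e.symm fun i => (f i).toAdd).toMul
               left_inv := fun a => by simp
               right_inv := fun f => by simp
               map_mul' := fun a b => by
                ext i
                simp }⟩⟩

theorem five_card_le_of_le_alpha {G : Type*} [Group G] [Fintype G] (h : 17 / 24 ≤ alpha G) :
    5 * Nat.card G ≤ 12 * (sqOne G).ncard := by
  have h1 := two_mul_numCyclic_le (G := G)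
  have h2 : (0 : ℚ) < Nat.card G := by exact_mod_cast Nat.card_pos
  rw [alpha, le_div_iff₀ h2] at h
  have : (5 : ℚ) * Nat.card G ≤ 12 * (sqOne G).ncard := by linarith
  exact_mod_cast this

theorem stmt_19 (G : Type*) [Group G] [Fintype G] (h : ¬ IsSupersolvable G) :
    alpha (Equiv.Perm (Fin 4)) = 17 / 24 ∧
    alpha G ≤ 17 / 24 ∧
      (alpha G = 17 / 24 ↔
        ∃ n : ℕ, Nonempty
          (G ≃* (Fin n → Multiplicative (ZMod 2)) × Equiv.Perm (Fin 4))) := by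
  refine ⟨alpha_eq_of_mulEquiv (A := PUnit.{1}) (fun _ => rfl) MulEquiv.uniqueProd.symm, ?_, ?_, ?_⟩
  · by_contra! hlt
    obtain ⟨K, _, hK, ⟨e⟩⟩ := exists_mulEquiv_prod_perm_four_of_not_isSupersolvable h
      (five_card_le_of_le_alpha hlt.le)
    exact hlt.ne' (alpha_eq_of_mulEquiv hK e)
  · intro heq
    obtain ⟨K, _, hK, ⟨e⟩⟩ := exists_mulEquiv_prod_perm_four_of_not_isSupersolvable h
      (five_card_le_of_le_alpha heq.ge)
    obtain ⟨n, ⟨e'⟩⟩ := exists_mulEquiv_zmod_two hK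
    exact ⟨n, ⟨e.trans (e'.prodCongr (MulEquiv.refl _))⟩⟩
  · rintro ⟨n, ⟨e⟩⟩
    have h2 : ∀ x : Multiplicative (ZMod 2), x * x = 1 := by decide
    exact alpha_eq_of_mulEquiv (fun a => funext fun i => h2 (a i)) e
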